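/- arXiv:2305.17601 — 11 statements merged into one kernel-verified Lean document; each statement's English description precedes it below -/
import Mathlib

section
/- Let S be any strictly proper scoring rule on the probability simplex Δ over n outcomes. Then for every interior point p* ∈ int(Δ) there exists a function f : Δ → Δ with Lipschitz constant L_f < 1 whose unique fixed point is p*, and a report p' ≠ p* such that S(p', f(p')) > S(p*, f(p*)); that is, the unique fixed point of f is not performatively optimal. -/
open Set
open scoped RealInnerProductSpace

noncomputable section

/-- The probability simplex over `n` outcomes, inside Euclidean space. -/
def probSimplex (n : ℕ) : Set (EuclideanSpace ℝ (Fin n)) :=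
  {p | (∀ i, 0 ≤ p i) ∧ ∑ i, p i = 1}

/-- Moving mass `t` from coordinate `j` to coordinate `i` stays in the simplex as long as
no coordinate becomes negative. -/
theorem add_smul_single_sub_single_mem_probSimplex {n : ℕ} {p : EuclideanSpace ℝ (Fin n)}
    (hp : p ∈ probSimplex n) {i j : Fin n} {t : ℝ} (ht : 0 ≤ t) (htj : t ≤ p j) :
    p + t • (EuclideanSpace.single i (1 : ℝ) - EuclideanSpace.single j (1 : ℝ))
      ∈ probSimplex n := by
  refine ⟨fun k => ?_, ?_⟩
  · have hk := hp.1 k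
    simp only [PiLp.add_apply, PiLp.smul_apply, PiLp.sub_apply, PiLp.single_apply, smul_eq_mul]
    split_ifs with hki hkj hkj <;> subst_vars <;> linarith
  · simp [Finset.sum_add_distrib, ← Finset.mul_sum, Finset.sum_sub_distrib, hp.2]

theorem convex_probSimplex (n : ℕ) : Convex ℝ (probSimplex n) := by
  intro x hx y hy a b ha hb hab
  refine ⟨fun k => ?_, ?_⟩
  · have := hx.1 k
    have := hy.1 k
    simp only [PiLp.add_apply, PiLp.smul_apply, smul_eq_mul]
    positivity
  · simp [Finset.sum_add_distrib, ← Finset.mul_sum, hx.2, hy.2, hab]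

/-- A strictly convex function on the simplex has no maximum at an interior point. -/
theorem exists_lt_of_strictConvexOn_probSimplex {n : ℕ} (hn : 2 ≤ n)
    {G : EuclideanSpace ℝ (Fin n) → ℝ} (hG : StrictConvexOn ℝ (probSimplex n) G)
    {p : EuclideanSpace ℝ (Fin n)} (hp : p ∈ probSimplex n) (hint : ∀ i, 0 < p i) :
    ∃ q ∈ probSimplex n, G p < G q := by
  obtain ⟨i, j, hij⟩ : ∃ i j : Fin n, i ≠ j :=
    ⟨⟨0, by omega⟩, ⟨1, by omega⟩, by simp⟩
  set t := min (p i) (p j)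
  have ht : 0 < t := lt_min (hint i) (hint j)
  set v := EuclideanSpace.single i (1 : ℝ) - EuclideanSpace.single j (1 : ℝ) with hv
  have hx : p + t • v ∈ probSimplex n :=
    add_smul_single_sub_single_mem_probSimplex hp ht.le (min_le_right _ _)
  have hy : p - t • v ∈ probSimplex n := by
    have := add_smul_single_sub_single_mem_probSimplex hp (i := j) (j := i) ht.le
      (min_le_left _ _)
    rwa [← neg_sub, smul_neg, ← sub_eq_add_neg] at this
  have hne : p + t • v ≠ p - t • v := by
    intro h
    have := congrArg (fun x : EuclideanSpace ℝ (Fin n) => x i) h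
    simp [hv, hij] at this
    linarith
  have hlt := hG.lt_on_openSegment hx hy hne
    (z := p) ⟨1 / 2, 1 / 2, by norm_num, by norm_num, by norm_num, by module⟩
  rcases lt_max_iff.1 hlt with h | h
  exacts [⟨_, hx, h⟩, ⟨_, hy, h⟩]

/-- For any strictly proper scoring rule
`S(p,q) = G(p) + ⟪g(p), q - p⟫` (Gneiting–Raftery: `G` strictly convex on the simplex,
`g` a subgradient of `G`), and any interior point `p*` of the simplex, there is a belief
map `f` from the simplex to itself with Lipschitz constant `< 1` whose unique fixed point
is `p*`, together with a report `p' ≠ p*` with `S(p', f p') > S(p*, f p*)`;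
i.e. the unique fixed point of `f` is not performatively optimal. -/
theorem stmt0 (n : ℕ) (hn : 2 ≤ n)
    (G : EuclideanSpace ℝ (Fin n) → ℝ)
    (g : EuclideanSpace ℝ (Fin n) → EuclideanSpace ℝ (Fin n))
    (hG : StrictConvexOn ℝ (probSimplex n) G)
    (hsub : ∀ p ∈ probSimplex n, ∀ q ∈ probSimplex n, G p + ⟪g p, q - p⟫ ≤ G q)
    (pstar : EuclideanSpace ℝ (Fin n))
    (hpstar : pstar ∈ probSimplex n) (hint : ∀ i, 0 < pstar i) :
    ∃ f : EuclideanSpace ℝ (Fin n) → EuclideanSpace ℝ (Fin n),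
      (∀ p ∈ probSimplex n, f p ∈ probSimplex n) ∧
      (∃ L : NNReal, L < 1 ∧ LipschitzOnWith L f (probSimplex n)) ∧
      f pstar = pstar ∧
      (∀ p ∈ probSimplex n, f p = p → p = pstar) ∧
      ∃ p' ∈ probSimplex n, p' ≠ pstar ∧
        G pstar + ⟪g pstar, f pstar - pstar⟫ < G p' + ⟪g p', f p' - p'⟫ := by
  obtain ⟨q, hq, hlt⟩ := exists_lt_of_strictConvexOn_probSimplex hn hG hpstar hint
  set d := G q - G pstar with hd
  have hd0 : 0 < d := sub_pos.2 hlt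
  set a := ⟪g q, q - pstar⟫ with ha
  obtain ⟨ε, hε0, hε1, hεa⟩ : ∃ ε : ℝ, 0 < ε ∧ ε < 1 ∧ ε * a < d := by
    have hpos : 0 < 2 * (d + |a|) := by positivity
    refine ⟨d / (2 * (d + |a|)), by positivity, ?_, ?_⟩
    · rw [div_lt_one hpos]
      linarith [abs_nonneg a]
    · rw [div_mul_eq_mul_div, div_lt_iff₀ hpos]
      nlinarith [le_abs_self a, abs_nonneg a]
  refine ⟨fun p => (1 - ε) • p + ε • pstar, fun p hp => ?_,
    ⟨(1 - ε).toNNReal, ?_, ?_⟩, by module, fun p _ hfp => ?_, q, hq, ?_, ?_⟩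
  · exact convex_probSimplex n hp hpstar (by linarith) hε0.le (by ring)
  · simpa using hε0
  · refine LipschitzOnWith.of_dist_le_mul fun x _ y _ => ?_
    rw [dist_add_right, dist_smul₀, Real.norm_of_nonneg (by linarith),
      Real.coe_toNNReal _ (by linarith)]
  · have h : ε • (pstar - p) = 0 := by
      rw [← sub_eq_zero.2 hfp]
      module
    exact (sub_eq_zero.1 ((smul_eq_zero.1 h).resolve_left hε0.ne')).symm
  · rintro rfl
    exact lt_irrefl _ hlt
  · have h₁ : (1 - ε) • pstar + ε • pstar - pstar = 0 := by module
    have h₂ : (1 - ε) • q + ε • pstar - q = -(ε • (q - pstar)) := by module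
    simp only [h₁, h₂, inner_zero_right, inner_neg_right, real_inner_smul_right, ← ha]
    linarith
end
end

section
/- Suppose G, g, and f are differentiable at p ∈ Δ (along the tangent space T). Then the gradient (in T) of the map x ↦ S(x, f(x)) at p equals Dg(p)ᵀ(f(p) − p) + Df(p)ᵀ g(p); equivalently, for every v ∈ T the derivative of t ↦ S(p + t v, f(p + t v)) at t = 0 equals vᵀ[Dg(p)ᵀ(f(p) − p) + Df(p)ᵀ g(p)]. Moreover, if S is strictly proper and p ∈ int(Δ) is a performatively optimal report, then (p − f(p))ᵀ Dg(p) = g(p)ᵀ Df(p). -/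
open Set
open scoped RealInnerProductSpace

noncomputable section

/-- The tangent space `T` of the probability simplex: vectors with coordinates summing to 0. -/
def tangentSp (n : ℕ) : Set (EuclideanSpace ℝ (Fin n)) :=
  {v | ∑ i, v i = 0}

/-- From a point with positive coordinates, small tangential displacements stay in the simplex. -/
theorem eventually_add_smul_mem_probSimplex {n : ℕ} {p v : EuclideanSpace ℝ (Fin n)}
    (hp : p ∈ probSimplex n) (hpos : ∀ i, 0 < p i) (hv : v ∈ tangentSp n) :
    ∀ᶠ t : ℝ in nhds 0, p + t • v ∈ probSimplex n := by
  have hcoord : ∀ i, ∀ᶠ t : ℝ in nhds 0, 0 < p i + t * v i := fun i =>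
    have hc : Continuous fun t : ℝ => p i + t * v i := by fun_prop
    hc.continuousAt.eventually_const_lt (by simpa using hpos i)
  filter_upwards [Filter.eventually_all.2 hcoord] with t ht
  refine ⟨fun i => by simpa using (ht i).le, ?_⟩
  have hv0 : ∑ i, v i = 0 := hv
  simp [Finset.sum_add_distrib, ← Finset.mul_sum, hv0, hp.2]

/-- If `G`, `g`, `f` are differentiable at `p ∈ Δ` along the tangent space
`T` (with directional derivatives given by the gradient `g p` of `G` and Jacobians `Dg`, `Df`),
then for every `v ∈ T` the derivative of `t ↦ S(p + t v, f (p + t v))` at `t = 0`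
(where `S(x,q) = G x + ⟪g x, q - x⟫`) equals
`vᵀ[Dg(p)ᵀ(f p − p) + Df(p)ᵀ g(p)] = ⟪f p - p, Dg v⟫ + ⟪g p, Df v⟫`.
Moreover, if `S` is strictly proper and `p ∈ int Δ` is a performatively optimal report, then
`(p − f p)ᵀ Dg(p) = g(p)ᵀ Df(p)` as linear functionals on `T`. -/
theorem stmt1 (n : ℕ)
    (G : EuclideanSpace ℝ (Fin n) → ℝ)
    (g f : EuclideanSpace ℝ (Fin n) → EuclideanSpace ℝ (Fin n))
    (p : EuclideanSpace ℝ (Fin n)) (hp : p ∈ probSimplex n)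
    (Dg Df : EuclideanSpace ℝ (Fin n) →L[ℝ] EuclideanSpace ℝ (Fin n))
    (hG' : ∀ v ∈ tangentSp n, HasDerivAt (fun t : ℝ => G (p + t • v)) ⟪g p, v⟫ 0)
    (hg' : ∀ v ∈ tangentSp n, HasDerivAt (fun t : ℝ => g (p + t • v)) (Dg v) 0)
    (hf' : ∀ v ∈ tangentSp n, HasDerivAt (fun t : ℝ => f (p + t • v)) (Df v) 0) :
    (∀ v ∈ tangentSp n,
      HasDerivAt
        (fun t : ℝ => G (p + t • v) + ⟪g (p + t • v), f (p + t • v) - (p + t • v)⟫)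
        (⟪f p - p, Dg v⟫ + ⟪g p, Df v⟫) 0) ∧
    (StrictConvexOn ℝ (probSimplex n) G →
      (∀ q ∈ probSimplex n, ∀ r ∈ probSimplex n, G q + ⟪g q, r - q⟫ ≤ G r) →
      (∀ q ∈ probSimplex n, f q ∈ probSimplex n) →
      (∀ i, 0 < p i) →
      (∀ q ∈ probSimplex n, G q + ⟪g q, f q - q⟫ ≤ G p + ⟪g p, f p - p⟫) →
      ∀ v ∈ tangentSp n, ⟪p - f p, Dg v⟫ = ⟪g p, Df v⟫) := by
  have hderiv : ∀ v ∈ tangentSp n,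
      HasDerivAt
        (fun t : ℝ => G (p + t • v) + ⟪g (p + t • v), f (p + t • v) - (p + t • v)⟫)
        (⟪f p - p, Dg v⟫ + ⟪g p, Df v⟫) 0 := by
    intro v hv
    have hline : HasDerivAt (fun t : ℝ => p + t • v) v 0 := by
      simpa using ((hasDerivAt_id (0 : ℝ)).smul_const v).const_add p
    refine ((hG' v hv).add ((hg' v hv).inner ℝ ((hf' v hv).sub hline))).congr_deriv ?_
    simp only [Pi.sub_apply, zero_smul, add_zero, inner_sub_right,
      real_inner_comm (Dg v)]
    ring
  refine ⟨hderiv, fun _ _ _ hpos hopt v hv => ?_⟩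
  have hmax : IsLocalMax
      (fun t : ℝ => G (p + t • v) + ⟪g (p + t • v), f (p + t • v) - (p + t • v)⟫) 0 := by
    filter_upwards [eventually_add_smul_mem_probSimplex hp hpos hv] with t ht
    simpa using hopt _ ht
  have hzero := hmax.hasDerivAt_eq_zero (hderiv v hv)
  rw [← neg_sub (f p) p, inner_neg_left]
  linarith
end
end

section
/- Let S be a strictly proper scoring rule with G, g as in the Gneiting–Raftery representation. Let p ∈ Δ and assume f, G, g are differentiable at p and that Dg(p)|_T ⪰ γ_p for some γ_p > 0. Then every performatively optimal report p satisfies ‖p − f(p)‖ ≤ ‖Df(p)‖_op · ‖g(p)‖ / γ_p. In particular, if f has Lipschitz constant L_f, G has Lipschitz constant L_G, and G is γ-strongly convex, then ‖p − f(p)‖ ≤ L_f · L_G / γ. -/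
open Set
open scoped RealInnerProductSpace

noncomputable section

open Filter Topology in
/-- A one-sided linear upper bound on a function bounds its derivative. -/
theorem HasDerivAt.le_of_forall_Ioc_le {φ : ℝ → ℝ} {φ' c : ℝ} (h : HasDerivAt φ φ' 0)
    (hle : ∀ t ∈ Ioc (0 : ℝ) 1, φ t ≤ φ 0 + t * c) : φ' ≤ c := by
  refine le_of_tendsto h.tendsto_slope_zero_right ?_
  filter_upwards [Ioc_mem_nhdsGT (zero_lt_one' ℝ)] with t ht
  rw [zero_add, smul_eq_mul, inv_mul_le_iff₀ ht.1]
  linarith [hle t ht]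

section InnerProductSpace

variable {E : Type*} [NormedAddCommGroup E] [InnerProductSpace ℝ E] {s : Set E} {G : E → ℝ}

/-- A subgradient of a strongly convex function supports it with a quadratic gain. -/
theorem StrongConvexOn.add_inner_add_le {γ : ℝ} (hγ : 0 ≤ γ) (hG : StrongConvexOn s γ G)
    {x a : E} (hx : x ∈ s) (ha : ∀ y ∈ s, G x + ⟪a, y - x⟫ ≤ G y) {y : E} (hy : y ∈ s) :
    G x + ⟪a, y - x⟫ + γ / 2 * ‖y - x‖ ^ 2 ≤ G y := by
  have hK : 0 ≤ γ / 2 * ‖y - x‖ ^ 2 := by positivity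
  set K := γ / 2 * ‖y - x‖ ^ 2 with hKdef
  have key : ∀ b : ℝ, 0 < b → b ≤ 1 → G x + ⟪a, y - x⟫ + (1 - b) * K ≤ G y := by
    intro b hb hb1
    have hconv := hG.2 hx hy (sub_nonneg.2 hb1) hb.le (sub_add_cancel 1 b)
    have hsub := ha _ (hG.1 hx hy (sub_nonneg.2 hb1) hb.le (sub_add_cancel 1 b))
    have hz : (1 - b) • x + b • y - x = b • (y - x) := by module
    rw [hz, inner_smul_right] at hsub
    simp only [smul_eq_mul, norm_sub_rev x y, ← hKdef] at hconv
    refine le_of_mul_le_mul_left ?_ hb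
    linarith
  by_contra! hlt
  set e := G x + ⟪a, y - x⟫ + K - G y with he
  have hepos : 0 < e := by linarith
  have hbound := key (e / (e + K)) (by positivity) ((div_le_one (by positivity)).2 (by linarith))
  have hdiv : e / (e + K) * (e + K) = e := div_mul_cancel₀ _ (by positivity)
  have hquot : 0 < e / (e + K) := by positivity
  nlinarith

/-- The gradient selection of a strongly convex function is strongly monotone. -/
theorem StrongConvexOn.mul_norm_sq_le_inner {γ : ℝ} (hγ : 0 ≤ γ) (hG : StrongConvexOn s γ G)
    {g : E → E} (hsub : ∀ x ∈ s, ∀ y ∈ s, G x + ⟪g x, y - x⟫ ≤ G y)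
    {x y : E} (hx : x ∈ s) (hy : y ∈ s) :
    γ * ‖y - x‖ ^ 2 ≤ ⟪y - x, g y - g x⟫ := by
  have hxy := hG.add_inner_add_le hγ hx (hsub x hx) hy
  have hyx := hG.add_inner_add_le hγ hy (hsub y hy) hx
  rw [← neg_sub y x, inner_neg_right, norm_neg] at hyx
  rw [real_inner_comm, inner_sub_left]
  linarith

/-- If `G` is Lipschitz on a convex set and has directional derivatives at `p` towards the points
of the set given by `a`, then `a` is bounded by the Lipschitz constant along differences of points
of the set, even when `p` lies on the boundary. -/
theorem inner_sub_le_of_lipschitz_of_hasDerivAt (hs : Convex ℝ s) {L : ℝ}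
    (hL : ∀ x ∈ s, ∀ y ∈ s, |G x - G y| ≤ L * ‖x - y‖) {p a q r : E}
    (hp : p ∈ s) (hq : q ∈ s) (hr : r ∈ s)
    (hG : ∀ x ∈ s, HasDerivAt (fun t : ℝ => G (p + t • (x - p))) ⟪a, x - p⟫ 0) :
    ⟪a, r - q⟫ ≤ L * ‖r - q‖ := by
  have hsub := (hG r hr).sub (hG q hq)
  rw [← inner_sub_right, sub_sub_sub_cancel_right] at hsub
  refine hsub.le_of_forall_Ioc_le fun t ht => ?_
  have hmem : ∀ x ∈ s, p + t • (x - p) ∈ s := fun x hx =>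
    hs.add_smul_sub_mem hp hx ⟨ht.1.le, ht.2⟩
  have hle := (le_abs_self _).trans (hL _ (hmem r hr) _ (hmem q hq))
  have hdiff : p + t • (r - p) - (p + t • (q - p)) = t • (r - q) := by module
  rw [hdiff, norm_smul, Real.norm_of_nonneg ht.1.le] at hle
  simp only [Pi.sub_apply, zero_smul, add_zero, sub_self, zero_add]
  linarith

/-- First-order condition, towards `f p`, for a maximizer `p` of `x ↦ G x + ⟪g x, f x - x⟫`. -/
theorem inner_add_inner_nonpos_of_isMaxOn (hs : Convex ℝ s) {g f : E → E} {p Dg Df : E}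
    (hp : p ∈ s) (hfp : f p ∈ s)
    (hG : HasDerivAt (fun t : ℝ => G (p + t • (f p - p))) ⟪g p, f p - p⟫ 0)
    (hg : HasDerivAt (fun t : ℝ => g (p + t • (f p - p))) Dg 0)
    (hf : HasDerivAt (fun t : ℝ => f (p + t • (f p - p))) Df 0)
    (hmax : IsMaxOn (fun x => G x + ⟪g x, f x - x⟫) s p) :
    ⟪f p - p, Dg⟫ + ⟪g p, Df⟫ ≤ 0 := by
  have hline : HasDerivAt (fun t : ℝ => p + t • (f p - p)) (f p - p) 0 := by
    simpa using ((hasDerivAt_id (0 : ℝ)).smul_const (f p - p)).const_add p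
  have hφ := hG.add (hg.inner ℝ (hf.sub hline))
  simp only [Pi.sub_apply, zero_smul, add_zero] at hφ
  have hle := hφ.le_of_forall_Ioc_le (c := 0) fun t ht => by
    have hopt := hmax (hs.add_smul_sub_mem hp hfp ⟨ht.1.le, ht.2⟩)
    simpa using hopt
  rw [inner_sub_right (g p) Df, real_inner_comm (f p - p) Dg] at hle
  linarith

end InnerProductSpace

theorem sub_mem_tangentSp {n : ℕ} {x y : EuclideanSpace ℝ (Fin n)}
    (hx : x ∈ probSimplex n) (hy : y ∈ probSimplex n) : x - y ∈ tangentSp n := by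
  simp [tangentSp, hx.2, hy.2]

/-- Every tangent direction is, up to positive scaling, a difference of points of the simplex. -/
theorem exists_pos_smul_eq_sub {n : ℕ} (hn : 0 < n) {v : EuclideanSpace ℝ (Fin n)}
    (hv : v ∈ tangentSp n) :
    ∃ c > (0 : ℝ), ∃ q ∈ probSimplex n, ∃ r ∈ probSimplex n, r - q = c • v := by
  have hn' : (0 : ℝ) < n := by exact_mod_cast hn
  have hc : (0 : ℝ) < 1 / (n * (‖v‖ + 1)) := by positivity
  refine ⟨_, hc, WithLp.toLp 2 fun _ => 1 / (n : ℝ), ⟨fun i => ?_, ?_⟩,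
    WithLp.toLp 2 (fun _ => 1 / (n : ℝ)) + (1 / (n * (‖v‖ + 1))) • v, ⟨fun i => ?_, ?_⟩,
    add_sub_cancel_left _ _⟩
  · simp
  · simp [hn'.ne']
  · have hvi : -(‖v‖ + 1) ≤ v i := by
      linarith [neg_abs_le (v i), Real.norm_eq_abs (v i), PiLp.norm_apply_le v i]
    have hmul := mul_le_mul_of_nonneg_left hvi hc.le
    have hcancel : 1 / (n * (‖v‖ + 1)) * -(‖v‖ + 1) = -(1 / (n : ℝ)) := by
      field_simp
    simp only [PiLp.add_apply, PiLp.smul_apply, smul_eq_mul]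
    linarith
  · have hv0 : ∑ i, v i = 0 := hv
    simp [Finset.sum_add_distrib, ← Finset.mul_sum, hv0, hn'.ne']

/-- The gradient of a Lipschitz function on the simplex is bounded by the Lipschitz constant,
also at boundary points. -/
theorem norm_le_of_lipschitz_probSimplex {n : ℕ} {G : EuclideanSpace ℝ (Fin n) → ℝ} {L : ℝ}
    (hL0 : 0 ≤ L) (hL : ∀ x ∈ probSimplex n, ∀ y ∈ probSimplex n, |G x - G y| ≤ L * ‖x - y‖)
    {p a : EuclideanSpace ℝ (Fin n)} (hp : p ∈ probSimplex n) (ha : a ∈ tangentSp n)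
    (hG : ∀ v ∈ tangentSp n, HasDerivAt (fun t : ℝ => G (p + t • v)) ⟪a, v⟫ 0) :
    ‖a‖ ≤ L := by
  have hn : 0 < n := by
    rcases Nat.eq_zero_or_pos n with rfl | hn
    · simpa using hp.2
    · exact hn
  obtain ⟨c, hc, q, hq, r, hr, hqr⟩ := exists_pos_smul_eq_sub hn ha
  have hle := inner_sub_le_of_lipschitz_of_hasDerivAt (convex_probSimplex n) hL hp hq hr
    fun x hx => hG _ (sub_mem_tangentSp hx hp)
  rw [hqr, inner_smul_right, real_inner_self_eq_norm_sq, norm_smul, Real.norm_of_nonneg hc.le]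
    at hle
  by_contra! hlt
  have hpos : 0 < ‖a‖ := hL0.trans_lt hlt
  nlinarith [mul_pos (mul_pos hc hpos) (sub_pos.2 hlt)]

/-- Cancelling one factor in a quadratic bound. -/
theorem le_div_of_mul_sq_le {γ x B : ℝ} (hγ : 0 < γ) (hx : 0 ≤ x) (hB : 0 ≤ B)
    (h : γ * x ^ 2 ≤ B * x) : x ≤ B / γ := by
  rw [le_div_iff₀ hγ]
  rcases hx.eq_or_lt with rfl | hx
  · simpa using hB
  · exact le_of_mul_le_mul_right (by linarith) hx

/-- Let `S(x,q) = G x + ⟪g x, q - x⟫` be a strictly proper scoring rule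
(Gneiting–Raftery), `p ∈ Δ` with `f, G, g` differentiable at `p` and `Dg(p)|_T ⪰ γₚ > 0`.
Then every performatively optimal report `p` satisfies
`‖p − f p‖ ≤ ‖Df(p)‖_op · ‖g p‖ / γₚ` (expressed by quantifying over all upper bounds `M`
of the operator norm of `Df(p)` on `T`). In particular, if `f` is `L_f`-Lipschitz on `Δ`,
`G` is `L_G`-Lipschitz on `Δ`, and `G` is `γ`-strongly convex on `Δ`, then
`‖p − f p‖ ≤ L_f · L_G / γ`. -/
theorem stmt3 (n : ℕ)
    (G : EuclideanSpace ℝ (Fin n) → ℝ)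
    (g f : EuclideanSpace ℝ (Fin n) → EuclideanSpace ℝ (Fin n))
    (hG : StrictConvexOn ℝ (probSimplex n) G)
    (hsub : ∀ q ∈ probSimplex n, ∀ r ∈ probSimplex n, G q + ⟪g q, r - q⟫ ≤ G r)
    (hgT : ∀ q ∈ probSimplex n, g q ∈ tangentSp n)
    (hf : ∀ q ∈ probSimplex n, f q ∈ probSimplex n)
    (p : EuclideanSpace ℝ (Fin n)) (hp : p ∈ probSimplex n)
    (Dg Df : EuclideanSpace ℝ (Fin n) →L[ℝ] EuclideanSpace ℝ (Fin n))
    (hG' : ∀ v ∈ tangentSp n, HasDerivAt (fun t : ℝ => G (p + t • v)) ⟪g p, v⟫ 0)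
    (hg' : ∀ v ∈ tangentSp n, HasDerivAt (fun t : ℝ => g (p + t • v)) (Dg v) 0)
    (hf' : ∀ v ∈ tangentSp n, HasDerivAt (fun t : ℝ => f (p + t • v)) (Df v) 0)
    (γp : ℝ) (hγp : 0 < γp)
    (hpos : ∀ v ∈ tangentSp n, γp * ‖v‖ ^ 2 ≤ ⟪v, Dg v⟫)
    (hopt : ∀ q ∈ probSimplex n, G q + ⟪g q, f q - q⟫ ≤ G p + ⟪g p, f p - p⟫) :
    (∀ M : ℝ, (∀ v ∈ tangentSp n, ‖Df v‖ ≤ M * ‖v‖) →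
      ‖p - f p‖ ≤ M * ‖g p‖ / γp) ∧
    (∀ Lf LG γ : ℝ, 0 ≤ Lf → 0 ≤ LG → 0 < γ →
      (∀ x ∈ probSimplex n, ∀ y ∈ probSimplex n, ‖f x - f y‖ ≤ Lf * ‖x - y‖) →
      (∀ x ∈ probSimplex n, ∀ y ∈ probSimplex n, |G x - G y| ≤ LG * ‖x - y‖) →
      StrongConvexOn (probSimplex n) γ G →
      ‖p - f p‖ ≤ Lf * LG / γ) := by
  have hfp := hf p hp
  have hv := sub_mem_tangentSp hfp hp
  have hfoc := inner_add_inner_nonpos_of_isMaxOn (convex_probSimplex n) hp hfp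
    (hG' _ hv) (hg' _ hv) (hf' _ hv) hopt
  have hmem : ∀ t ∈ Ioc (0 : ℝ) 1, p + t • (f p - p) ∈ probSimplex n := fun t ht =>
    (convex_probSimplex n).add_smul_sub_mem hp hfp ⟨ht.1.le, ht.2⟩
  rw [norm_sub_rev]
  refine ⟨fun M hM => ?_, fun Lf LG γ hLf hLG hγ hfL hGL hGs => ?_⟩
  · refine le_div_of_mul_sq_le hγp (norm_nonneg _) ?_ ?_
    · rcases (norm_nonneg (g p)).eq_or_lt with h0 | h0
      · simp [← h0]
      · exact (norm_nonneg _).trans (hM _ (hgT p hp))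
    · have hcs := neg_le_of_abs_le (abs_real_inner_le_norm (g p) (Df (f p - p)))
      have hop := mul_le_mul_of_nonneg_left (hM _ hv) (norm_nonneg (g p))
      linarith [hpos _ hv]
  · have hgp : ‖g p‖ ≤ LG :=
      norm_le_of_lipschitz_probSimplex hLG hGL hp (hgT p hp) hG'
    have hDg : -⟪f p - p, Dg (f p - p)⟫ ≤ -(γ * ‖f p - p‖ ^ 2) := by
      have hderiv := ((hasDerivAt_const (0 : ℝ) (f p - p)).inner ℝ (hg' _ hv)).neg
      simp only [inner_zero_left, add_zero] at hderiv
      refine hderiv.le_of_forall_Ioc_le fun t ht => ?_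
      have hmono := hGs.mul_norm_sq_le_inner hγ.le hsub hp (hmem t ht)
      rw [add_sub_cancel_left, norm_smul, Real.norm_of_nonneg ht.1.le, real_inner_smul_left,
        inner_sub_right] at hmono
      have hdiv : t * (γ * ‖f p - p‖ ^ 2) ≤
          ⟪f p - p, g (p + t • (f p - p))⟫ - ⟪f p - p, g p⟫ :=
        le_of_mul_le_mul_left (by linarith) ht.1
      simp only [Pi.neg_apply, zero_smul, add_zero]
      linarith
    have hDf : -⟪g p, Df (f p - p)⟫ ≤ Lf * LG * ‖f p - p‖ := by
      have hderiv := ((hasDerivAt_const (0 : ℝ) (g p)).inner ℝ (hf' _ hv)).neg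
      simp only [inner_zero_left, add_zero] at hderiv
      refine hderiv.le_of_forall_Ioc_le fun t ht => ?_
      have hlip := hfL _ (hmem t ht) _ hp
      rw [add_sub_cancel_left, norm_smul, Real.norm_of_nonneg ht.1.le] at hlip
      have hcs := neg_le_of_abs_le
        (abs_real_inner_le_norm (g p) (f (p + t • (f p - p)) - f p))
      rw [inner_sub_right] at hcs
      have hprod := mul_le_mul hgp hlip (norm_nonneg _) hLG
      simp only [Pi.neg_apply, zero_smul, add_zero]
      linarith
    exact le_div_of_mul_sq_le hγ (norm_nonneg _) (mul_nonneg hLf hLG) (by linarith)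
end
end

section
/- Let S be a strictly proper scoring rule with G, g as in the Gneiting–Raftery representation, let p ∈ Δ with f, G, g differentiable at p and Dg(p)|_T ⪰ γ_p for some γ_p > 0, and assume additionally that f has Lipschitz constant L_f < 1. Let p* be the unique fixed point of f. Then every performatively optimal report p satisfies ‖p − p*‖ ≤ ‖g(p)‖ · ‖Df(p)‖_op / ((1 − L_f) γ_p) ≤ L_f · ‖g(p)‖ / ((1 − L_f) γ_p). -/
open Set
open scoped RealInnerProductSpace

noncomputable section

/-- Moving from `p` towards another point of the simplex stays in the simplex for small times. -/
theorem eventually_add_smul_mem_probSimplex_s4 {n : ℕ} {p q : EuclideanSpace ℝ (Fin n)}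
    (hp : p ∈ probSimplex n) (hq : q ∈ probSimplex n) :
    ∀ᶠ t : ℝ in nhdsWithin 0 (Ioi 0), 0 < t ∧ p + t • (q - p) ∈ probSimplex n := by
  filter_upwards [Ioo_mem_nhdsGT (zero_lt_one' ℝ)] with t ht
  exact ⟨ht.1, (convex_probSimplex n).add_smul_sub_mem hp hq ⟨ht.1.le, ht.2.le⟩⟩

/-- A derivative at `0` is bounded by any eventual right-sided Lipschitz bound. -/
theorem HasDerivAt.norm_le_of_eventually_right {E : Type*} [NormedAddCommGroup E]
    [NormedSpace ℝ E] {h : ℝ → E} {h' : E} {C : ℝ} (hh : HasDerivAt h h' 0)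
    (hC : ∀ᶠ t : ℝ in nhdsWithin 0 (Ioi 0), 0 < t ∧ ‖h t - h 0‖ ≤ C * t) : ‖h'‖ ≤ C := by
  refine le_of_tendsto hh.tendsto_slope_zero_right.norm ?_
  filter_upwards [hC] with t ⟨ht, hle⟩
  rw [zero_add, norm_smul, norm_inv, Real.norm_of_nonneg ht.le, inv_mul_le_iff₀ ht]
  linarith

/-- A derivative at `0` is nonpositive if `0` is a right-sided local maximum. -/
theorem HasDerivAt.nonpos_of_eventually_right {h : ℝ → ℝ} {h' : ℝ} (hh : HasDerivAt h h' 0)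
    (hmax : ∀ᶠ t : ℝ in nhdsWithin 0 (Ioi 0), 0 < t ∧ h t ≤ h 0) : h' ≤ 0 := by
  refine le_of_tendsto hh.tendsto_slope_zero_right ?_
  filter_upwards [hmax] with t ⟨ht, hle⟩
  rw [zero_add, smul_eq_mul]
  exact mul_nonpos_of_nonneg_of_nonpos (inv_nonneg.2 ht.le) (by linarith)

/-- Let `S(x,q) = G x + ⟪g x, q - x⟫` be a strictly proper scoring rule,
`p ∈ Δ` with `f, G, g` differentiable at `p` and `Dg(p)|_T ⪰ γₚ > 0`, and assume `f` has
Lipschitz constant `L_f < 1` on `Δ`, with (unique, by Banach) fixed point `p*`.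
Then every performatively optimal report `p` satisfies
`‖p − p*‖ ≤ ‖g p‖ · ‖Df(p)‖_op / ((1 − L_f) γₚ) ≤ L_f · ‖g p‖ / ((1 − L_f) γₚ)`
(the first inequality expressed by quantifying over all upper bounds `M` of the operator
norm of `Df(p)` on `T`). -/
theorem stmt4 (n : ℕ)
    (G : EuclideanSpace ℝ (Fin n) → ℝ)
    (g f : EuclideanSpace ℝ (Fin n) → EuclideanSpace ℝ (Fin n))
    (hG : StrictConvexOn ℝ (probSimplex n) G)
    (hsub : ∀ q ∈ probSimplex n, ∀ r ∈ probSimplex n, G q + ⟪g q, r - q⟫ ≤ G r)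
    (hgT : ∀ q ∈ probSimplex n, g q ∈ tangentSp n)
    (hf : ∀ q ∈ probSimplex n, f q ∈ probSimplex n)
    (p : EuclideanSpace ℝ (Fin n)) (hp : p ∈ probSimplex n)
    (Dg Df : EuclideanSpace ℝ (Fin n) →L[ℝ] EuclideanSpace ℝ (Fin n))
    (hG' : ∀ v ∈ tangentSp n, HasDerivAt (fun t : ℝ => G (p + t • v)) ⟪g p, v⟫ 0)
    (hg' : ∀ v ∈ tangentSp n, HasDerivAt (fun t : ℝ => g (p + t • v)) (Dg v) 0)
    (hf' : ∀ v ∈ tangentSp n, HasDerivAt (fun t : ℝ => f (p + t • v)) (Df v) 0)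
    (γp : ℝ) (hγp : 0 < γp)
    (hpos : ∀ v ∈ tangentSp n, γp * ‖v‖ ^ 2 ≤ ⟪v, Dg v⟫)
    (Lf : ℝ) (hLf0 : 0 ≤ Lf) (hLf1 : Lf < 1)
    (hLip : ∀ x ∈ probSimplex n, ∀ y ∈ probSimplex n, ‖f x - f y‖ ≤ Lf * ‖x - y‖)
    (pstar : EuclideanSpace ℝ (Fin n)) (hpstar : pstar ∈ probSimplex n)
    (hfix : f pstar = pstar)
    (hopt : ∀ q ∈ probSimplex n, G q + ⟪g q, f q - q⟫ ≤ G p + ⟪g p, f p - p⟫) :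
    (∀ M : ℝ, (∀ v ∈ tangentSp n, ‖Df v‖ ≤ M * ‖v‖) →
      ‖p - pstar‖ ≤ ‖g p‖ * M / ((1 - Lf) * γp)) ∧
    ‖p - pstar‖ ≤ Lf * ‖g p‖ / ((1 - Lf) * γp) := by
  set v := f p - p with hv
  have hvT : v ∈ tangentSp n := sub_mem_tangentSp (hf p hp) hp
  have hfeas := eventually_add_smul_mem_probSimplex_s4 hp (hf p hp)
  rw [← hv] at hfeas
  have hfirst : ⟪v, Dg v⟫ + ⟪g p, Df v⟫ ≤ 0 := by
    have hline : HasDerivAt (fun t : ℝ => p + t • v) v 0 := by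
      simpa using ((hasDerivAt_id (0 : ℝ)).smul_const v).const_add p
    have hscore := (hG' v hvT).add ((hg' v hvT).inner ℝ ((hf' v hvT).sub hline))
    have hle := hscore.nonpos_of_eventually_right (by
      filter_upwards [hfeas] with t ⟨ht, hmem⟩
      exact ⟨ht, by simpa using hopt _ hmem⟩)
    simp only [Pi.sub_apply, zero_smul, add_zero, ← hv, inner_sub_right] at hle
    rw [real_inner_comm]
    linarith
  have hLipDf : ‖Df v‖ ≤ Lf * ‖v‖ := by
    refine (hf' v hvT).norm_le_of_eventually_right ?_
    filter_upwards [hfeas] with t ⟨ht, hmem⟩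
    refine ⟨ht, ?_⟩
    have := hLip _ hmem p hp
    rw [add_sub_cancel_left, norm_smul, Real.norm_of_nonneg ht.le] at this
    simp only [zero_smul, add_zero]
    linarith
  have hdist : (1 - Lf) * ‖p - pstar‖ ≤ ‖v‖ := by
    have hcontr := hLip p hp pstar hpstar
    have htri := norm_sub_le_norm_sub_add_norm_sub p (f p) pstar
    rw [hfix] at hcontr
    rw [norm_sub_rev p (f p), ← hv] at htri
    linarith
  have hbound : ∀ K : ℝ, 0 ≤ ‖g p‖ * K → ‖Df v‖ ≤ K * ‖v‖ →
      ‖p - pstar‖ ≤ ‖g p‖ * K / ((1 - Lf) * γp) := by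
    intro K hK hDf
    have hv_le : γp * ‖v‖ ≤ ‖g p‖ * K := by
      rcases (norm_nonneg v).eq_or_lt with h0 | h0
      · rwa [← h0, mul_zero]
      · have hcs := neg_le_of_abs_le (abs_real_inner_le_norm (g p) (Df v))
        have hmul := mul_le_mul_of_nonneg_left hDf (norm_nonneg (g p))
        have := hpos v hvT
        refine le_of_mul_le_mul_right ?_ h0
        nlinarith
    rw [le_div_iff₀ (mul_pos (sub_pos.2 hLf1) hγp)]
    nlinarith
  refine ⟨fun M hM => hbound M ?_ (hM v hvT), ?_⟩
  · rw [mul_comm]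
    exact (norm_nonneg _).trans (hM (g p) (hgT p hp))
  · rw [mul_comm Lf]
    exact hbound Lf (mul_nonneg (norm_nonneg _) hLf0) hLipDf
end
end

section
/- In the binary case, for any strictly proper scoring rule S and any ε > 0 there exists a function f : [0,1] → [0,1] with Lipschitz constant strictly smaller than 1 such that, writing p* for the unique fixed point of f, every performatively optimal report p satisfies |p − p*| ≥ 1 − ε. Consequently, no bound on the distance from the fixed point better than the trivial one holds uniformly over all f with Lipschitz constant below 1. -/
open Set

/-- A strictly convex function on `[0,1]` with `G 0 ≤ G 1` stays below `G 1` on `(0,1)`. -/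
theorem StrictConvexOn.lt_right_of_unit {G : ℝ → ℝ} (hG : StrictConvexOn ℝ (Icc (0:ℝ) 1) G)
    (h01 : G 0 ≤ G 1) {x : ℝ} (hx0 : 0 < x) (hx1 : x < 1) : G x < G 1 := by
  have h := hG.2 (left_mem_Icc.2 zero_le_one) (right_mem_Icc.2 zero_le_one) zero_ne_one
    (sub_pos.2 hx1) hx0 (by ring)
  simp only [smul_eq_mul, mul_zero, mul_one, zero_add] at h
  nlinarith

/-- For `G 0 ≤ G 1`, a map that is constant up to a small fixed point and has slope close to `1`
beyond it only admits performatively optimal reports close to `1`. -/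
theorem exists_lipschitz_optimal_far_of_le (G g : ℝ → ℝ)
    (hG : StrictConvexOn ℝ (Icc (0:ℝ) 1) G)
    (hsub : ∀ p ∈ Icc (0:ℝ) 1, ∀ q ∈ Icc (0:ℝ) 1, G p + g p * (q - p) ≤ G q)
    (h01 : G 0 ≤ G 1) (ε : ℝ) (hε : 0 < ε) :
    ∃ f : ℝ → ℝ,
      (∀ x ∈ Icc (0:ℝ) 1, f x ∈ Icc (0:ℝ) 1) ∧
      (∃ L : NNReal, L < 1 ∧ LipschitzOnWith L f (Icc (0:ℝ) 1)) ∧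
      ∃ pstar ∈ Icc (0:ℝ) 1, f pstar = pstar ∧
        (∀ q ∈ Icc (0:ℝ) 1, f q = q → q = pstar) ∧
        ∀ p ∈ Icc (0:ℝ) 1,
          (∀ x ∈ Icc (0:ℝ) 1, g x * (f x - x) + G x ≤ g p * (f p - p) + G p) →
          1 - ε ≤ |p - pstar| := by
  obtain ⟨e, he0, he1, heε⟩ : ∃ e : ℝ, 0 < e ∧ e ≤ 1 / 4 ∧ 2 * e ≤ ε :=
    ⟨min (ε / 2) (1 / 4), by positivity, min_le_right _ _,
      by linarith [min_le_left (ε / 2) (1 / 4)]⟩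
  have heI : e ∈ Icc (0:ℝ) 1 := ⟨he0.le, by linarith⟩
  have he'I : 1 - e ∈ Icc (0:ℝ) 1 := ⟨by linarith, by linarith⟩
  have hone : (1:ℝ) ∈ Icc (0:ℝ) 1 := right_mem_Icc.2 zero_le_one
  set m := max (G e) (G (1 - e))
  have hm1 : m < G 1 := max_lt (hG.lt_right_of_unit h01 he0 (by linarith))
    (hG.lt_right_of_unit h01 (by linarith) (by linarith))
  obtain ⟨δ, hδ0, hδ1, hδ⟩ : ∃ δ : ℝ, 0 < δ ∧ δ < 1 ∧ δ * |g 1| < G 1 - m := by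
    have hgap : 0 < G 1 - m := sub_pos.2 hm1
    have hden : 0 < |g 1| + 1 := by positivity
    refine ⟨min (1 / 2) ((G 1 - m) / (|g 1| + 1)), by positivity,
      (min_le_left _ _).trans_lt (by norm_num), ?_⟩
    set δ := min (1 / 2) ((G 1 - m) / (|g 1| + 1))
    have hpos : 0 < δ := by positivity
    have hle : δ * (|g 1| + 1) ≤ G 1 - m := (le_div_iff₀ hden).1 (min_le_right _ _)
    linarith
  have hleft : ∀ x, x ≤ e → e + (1 - δ) * max (x - e) 0 = e := fun x hx => by
    rw [max_eq_right (by linarith)]; ring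
  have hright : ∀ x, e ≤ x → e + (1 - δ) * max (x - e) 0 = x - δ * (x - e) := fun x hx => by
    rw [max_eq_left (by linarith)]; ring
  refine ⟨fun x => e + (1 - δ) * max (x - e) 0, ?_, ⟨(1 - δ).toNNReal, ?_, ?_⟩,
    e, heI, hleft e le_rfl, ?_, ?_⟩
  · rintro x ⟨-, hx1⟩
    rcases le_total x e with h | h
    · simpa only [hleft x h] using heI
    · simp only [hright x h]
      constructor <;> nlinarith
  · simpa using hδ0
  · refine LipschitzOnWith.of_dist_le_mul fun x _ y _ => ?_
    have habs := abs_max_sub_max_le_abs (x - e) (y - e) 0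
    rw [sub_sub_sub_cancel_right] at habs
    simp only [Real.dist_eq, add_sub_add_left_eq_sub, ← mul_sub, abs_mul,
      abs_of_pos (sub_pos.2 hδ1), Real.coe_toNNReal _ (sub_pos.2 hδ1).le]
    exact mul_le_mul_of_nonneg_left habs (by linarith)
  · intro q _ hq
    rcases le_total q e with h | h
    · exact hq.symm.trans (hleft q h)
    · have hq' := (hright q h).symm.trans hq
      nlinarith
  · intro p hp hopt
    have hscore := hopt 1 hone
    simp only [hright 1 heI.2] at hscore
    have hg1 : δ * (g 1 * (1 - e)) ≤ δ * |g 1| := by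
      refine mul_le_mul_of_nonneg_left ?_ hδ0.le
      nlinarith [le_abs_self (g 1), abs_nonneg (g 1)]
    have hpe := hsub p hp e heI
    have hlow : m < g p * (e + (1 - δ) * max (p - e) 0 - p) + G p := by linarith
    suffices 1 - e < p by
      rw [abs_of_nonneg (by linarith)]; linarith
    by_contra! hple
    refine hlow.not_ge ?_
    rcases le_total p e with h | h
    · rw [hleft p h]
      linarith [le_max_left (G e) (G (1 - e))]
    · rw [hright p h]
      have hGp : G p ≤ m := hG.convexOn.le_max_of_mem_Icc heI he'I ⟨h, hple⟩
      have hGe : G e ≤ m := le_max_left _ _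
      nlinarith

/-- (Binary case.) For any strictly proper scoring rule
`S(p,q) = g p * (q - p) + G p` (`G` strictly convex on `[0,1]`, `g` a subgradient of `G`)
and any `ε > 0`, there exists `f : [0,1] → [0,1]` with Lipschitz constant strictly smaller
than `1` such that, writing `p*` for the unique fixed point of `f`, every performatively
optimal report `p` satisfies `|p − p*| ≥ 1 − ε`. -/
theorem stmt5 (G g : ℝ → ℝ)
    (hG : StrictConvexOn ℝ (Icc (0:ℝ) 1) G)
    (hsub : ∀ p ∈ Icc (0:ℝ) 1, ∀ q ∈ Icc (0:ℝ) 1, G p + g p * (q - p) ≤ G q)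
    (ε : ℝ) (hε : 0 < ε) :
    ∃ f : ℝ → ℝ,
      (∀ x ∈ Icc (0:ℝ) 1, f x ∈ Icc (0:ℝ) 1) ∧
      (∃ L : NNReal, L < 1 ∧ LipschitzOnWith L f (Icc (0:ℝ) 1)) ∧
      ∃ pstar ∈ Icc (0:ℝ) 1, f pstar = pstar ∧
        (∀ q ∈ Icc (0:ℝ) 1, f q = q → q = pstar) ∧
        ∀ p ∈ Icc (0:ℝ) 1,
          (∀ x ∈ Icc (0:ℝ) 1, g x * (f x - x) + G x ≤ g p * (f p - p) + G p) →
          1 - ε ≤ |p - pstar| := by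
  rcases le_total (G 0) (G 1) with h01 | h10
  · exact exists_lipschitz_optimal_far_of_le G g hG hsub h01 ε hε
  have hrefl : ∀ x ∈ Icc (0:ℝ) 1, 1 - x ∈ Icc (0:ℝ) 1 := fun x hx =>
    ⟨by linarith [hx.2], by linarith [hx.1]⟩
  have hG' : StrictConvexOn ℝ (Icc (0:ℝ) 1) fun x => G (1 - x) := by
    refine ⟨convex_Icc 0 1, fun x hx y hy hxy a b ha hb hab => ?_⟩
    have h := hG.2 (hrefl x hx) (hrefl y hy) (fun h => hxy (by linarith)) ha hb hab
    simp only [smul_eq_mul] at h ⊢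
    convert h using 2
    linear_combination -hab
  obtain ⟨f, hmaps, ⟨L, hL, hLip⟩, c, hc, hfix, huniq, hfar⟩ :=
    exists_lipschitz_optimal_far_of_le (fun x => G (1 - x)) (fun x => -g (1 - x)) hG'
      (fun p hp q hq => by
        have h := hsub _ (hrefl p hp) _ (hrefl q hq)
        linarith)
      (by simpa using h10) ε hε
  refine ⟨fun x => 1 - f (1 - x), fun x hx => hrefl _ (hmaps _ (hrefl x hx)), ⟨L, hL, ?_⟩,
    1 - c, hrefl c hc, by simp [hfix], fun q hq hfq => ?_, fun p hp hopt => ?_⟩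
  · refine LipschitzOnWith.of_dist_le_mul fun x hx y hy => ?_
    simpa only [dist_sub_left] using hLip.dist_le_mul _ (hrefl x hx) _ (hrefl y hy)
  · linarith [huniq (1 - q) (hrefl q hq) (by linarith)]
  · have h := hfar (1 - p) (hrefl p hp) fun x hx => by
      have h := hopt (1 - x) (hrefl x hx)
      simp only [sub_sub_cancel] at h ⊢
      linarith
    rwa [abs_sub_comm, show c - (1 - p) = p - (1 - c) by ring] at h
end

section
/- In the binary case, for every L_f ≥ 0 and every ε > 0 there exists a strictly proper scoring rule S such that for every f : [0,1] → [0,1] with Lipschitz constant L_f, every performatively optimal report p satisfies √2 · |p − f(p)| ≤ ε. Moreover, if L_f < 1, there exists a strictly proper scoring rule S such that for every f with Lipschitz constant L_f, every performatively optimal report p satisfies √2 · |p − p*| ≤ ε, where p* is the unique fixed point of f. (In particular the exponential scoring rule with g(p) = e^{Kp} for K = L_f/(√2 ε), resp. K = (1 − L_f)/(√2 ε L_f), achieves these bounds.) -/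
open Set

open Filter Topology

/-- If `A * exp (k * t)` dominates the line `A + C * t` for small `t > 0`, its slope at `0`
is at least `C`. -/
lemma le_mul_of_add_mul_le_mul_exp {A C k δ : ℝ} (hδ : 0 < δ)
    (h : ∀ t, 0 < t → t ≤ δ → A + C * t ≤ A * Real.exp (k * t)) : C ≤ A * k := by
  have hd : HasDerivAt (fun t : ℝ => A * Real.exp (k * t)) (A * k) 0 := by
    simpa using (((hasDerivAt_id (0 : ℝ)).const_mul k).exp).const_mul A
  refine ge_of_tendsto hd.tendsto_slope_zero_right ?_
  filter_upwards [Ioc_mem_nhdsGT hδ] with t ht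
  have := h t ht.1 ht.2
  simp only [zero_add, mul_zero, Real.exp_zero, mul_one, smul_eq_mul]
  rw [inv_mul_eq_div, le_div_iff₀ ht.1]
  linarith

lemma strictConvexOn_exp_mul_div {K : ℝ} (hK : 0 < K) {s : Set ℝ} (hs : Convex ℝ s) :
    StrictConvexOn ℝ s (fun x => Real.exp (K * x) / K) := by
  refine ⟨hs, fun x _ y _ hxy a b ha hb hab => ?_⟩
  have h := strictConvexOn_exp.2 (mem_univ (K * x)) (mem_univ (K * y))
    (fun h => hxy (mul_left_cancel₀ hK.ne' h)) ha hb hab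
  simp only [smul_eq_mul] at h ⊢
  rw [show K * (a * x + b * y) = a * (K * x) + b * (K * y) by ring, div_lt_iff₀ hK]
  refine h.trans_eq ?_
  field_simp

lemma exp_mul_div_add_le {K : ℝ} (hK : 0 < K) (p q : ℝ) :
    Real.exp (K * p) / K + Real.exp (K * p) * (q - p) ≤ Real.exp (K * q) / K := by
  have h := Real.add_one_le_exp (K * (q - p))
  have hq : Real.exp (K * q) = Real.exp (K * p) * Real.exp (K * (q - p)) := by
    rw [← Real.exp_add]; ring_nf
  rw [hq, le_div_iff₀ hK]
  calc _ = Real.exp (K * p) * (K * (q - p) + 1) := by field_simp; ring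
    _ ≤ _ := by gcongr

/-- Under the exponential scoring rule with parameter `K`, a performatively optimal report `p`
satisfies `K * |p - f p| ≤ L`. -/
lemma mul_abs_sub_le_of_exp_optimal {K L : ℝ} (hK : 0 < K) (hL : 0 ≤ L) {f : ℝ → ℝ}
    (hf : ∀ x ∈ Icc (0:ℝ) 1, f x ∈ Icc (0:ℝ) 1)
    (hlip : ∀ x ∈ Icc (0:ℝ) 1, ∀ y ∈ Icc (0:ℝ) 1, |f x - f y| ≤ L * |x - y|)
    {p : ℝ} (hp : p ∈ Icc (0:ℝ) 1)
    (hopt : ∀ x ∈ Icc (0:ℝ) 1, Real.exp (K * x) * (f x - x) + Real.exp (K * x) / K ≤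
      Real.exp (K * p) * (f p - p) + Real.exp (K * p) / K) :
    K * |p - f p| ≤ L := by
  have hopt' : ∀ x ∈ Icc (0:ℝ) 1,
      f x - x + 1 / K ≤ (f p - p + 1 / K) * Real.exp (K * (p - x)) := by
    intro x hx
    have hpx : Real.exp (K * p) = Real.exp (K * x) * Real.exp (K * (p - x)) := by
      rw [← Real.exp_add]; ring_nf
    have h := hopt x hx
    rw [hpx] at h
    refine le_of_mul_le_mul_left ?_ (Real.exp_pos (K * x))
    calc _ = Real.exp (K * x) * (f x - x) + Real.exp (K * x) / K := by ring
      _ ≤ _ := h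
      _ = _ := by ring
  have hfp := hf p hp
  rcases lt_trichotomy (f p) p with hlt | heq | hgt
  · have key : 1 - L ≤ (f p - p + 1 / K) * K := by
      refine le_mul_of_add_mul_le_mul_exp (δ := p) (hfp.1.trans_lt hlt) fun t ht htp => ?_
      have hx : p - t ∈ Icc (0:ℝ) 1 := ⟨by linarith, by linarith [hp.2]⟩
      have h1 := hopt' _ hx
      have h2 := (abs_le.1 (hlip _ hx p hp)).1
      rw [show p - t - p = -t by ring, abs_neg, abs_of_pos ht] at h2
      rw [show p - (p - t) = t by ring] at h1
      linarith
    rw [add_mul, one_div_mul_cancel hK.ne'] at key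
    rw [abs_of_pos (sub_pos.2 hlt)]
    linarith
  · simpa [heq] using hL
  · have key : -(L + 1) ≤ (f p - p + 1 / K) * -K := by
      refine le_mul_of_add_mul_le_mul_exp (δ := 1 - p) (by linarith [hfp.2]) fun t ht htp => ?_
      have hx : p + t ∈ Icc (0:ℝ) 1 := ⟨by linarith [hp.1], by linarith⟩
      have h1 := hopt' _ hx
      have h2 := (abs_le.1 (hlip _ hx p hp)).1
      rw [show p + t - p = t by ring, abs_of_pos ht] at h2
      rw [show K * (p - (p + t)) = -K * t by ring] at h1
      linarith
    rw [mul_neg, add_mul, one_div_mul_cancel hK.ne'] at key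
    rw [abs_of_neg (sub_neg.2 hgt)]
    linarith

/-- (Binary case.) For every `L_f ≥ 0` and `ε > 0` there is a strictly
proper scoring rule `S(p,q) = g p * (q - p) + G p` such that for every
`f : [0,1] → [0,1]` with Lipschitz constant `L_f`, every performatively optimal report `p`
satisfies `√2 · |p − f p| ≤ ε`. Moreover, if `L_f < 1`, there is a strictly proper scoring
rule such that for every such `f`, every performatively optimal report `p` satisfies
`√2 · |p − p*| ≤ ε`, where `p*` is the unique fixed point of `f`. -/
theorem stmt6 (Lf ε : ℝ) (hLf : 0 ≤ Lf) (hε : 0 < ε) :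
    (∃ G g : ℝ → ℝ,
      StrictConvexOn ℝ (Icc (0:ℝ) 1) G ∧
      (∀ p ∈ Icc (0:ℝ) 1, ∀ q ∈ Icc (0:ℝ) 1, G p + g p * (q - p) ≤ G q) ∧
      ∀ f : ℝ → ℝ, (∀ x ∈ Icc (0:ℝ) 1, f x ∈ Icc (0:ℝ) 1) →
        (∀ x ∈ Icc (0:ℝ) 1, ∀ y ∈ Icc (0:ℝ) 1, |f x - f y| ≤ Lf * |x - y|) →
        ∀ p ∈ Icc (0:ℝ) 1,
          (∀ x ∈ Icc (0:ℝ) 1, g x * (f x - x) + G x ≤ g p * (f p - p) + G p) →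
          Real.sqrt 2 * |p - f p| ≤ ε) ∧
    (Lf < 1 →
      ∃ G g : ℝ → ℝ,
        StrictConvexOn ℝ (Icc (0:ℝ) 1) G ∧
        (∀ p ∈ Icc (0:ℝ) 1, ∀ q ∈ Icc (0:ℝ) 1, G p + g p * (q - p) ≤ G q) ∧
        ∀ f : ℝ → ℝ, (∀ x ∈ Icc (0:ℝ) 1, f x ∈ Icc (0:ℝ) 1) →
          (∀ x ∈ Icc (0:ℝ) 1, ∀ y ∈ Icc (0:ℝ) 1, |f x - f y| ≤ Lf * |x - y|) →
          ∀ p ∈ Icc (0:ℝ) 1,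
            (∀ x ∈ Icc (0:ℝ) 1, g x * (f x - x) + G x ≤ g p * (f p - p) + G p) →
            ∀ pstar ∈ Icc (0:ℝ) 1, f pstar = pstar →
              Real.sqrt 2 * |p - pstar| ≤ ε) := by
  have main : ∀ η : ℝ, 0 < η → ∃ G g : ℝ → ℝ,
      StrictConvexOn ℝ (Icc (0:ℝ) 1) G ∧
      (∀ p ∈ Icc (0:ℝ) 1, ∀ q ∈ Icc (0:ℝ) 1, G p + g p * (q - p) ≤ G q) ∧
      ∀ f : ℝ → ℝ, (∀ x ∈ Icc (0:ℝ) 1, f x ∈ Icc (0:ℝ) 1) →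
        (∀ x ∈ Icc (0:ℝ) 1, ∀ y ∈ Icc (0:ℝ) 1, |f x - f y| ≤ Lf * |x - y|) →
        ∀ p ∈ Icc (0:ℝ) 1,
          (∀ x ∈ Icc (0:ℝ) 1, g x * (f x - x) + G x ≤ g p * (f p - p) + G p) →
          Real.sqrt 2 * |p - f p| ≤ η := by
    intro η hη
    have hK : 0 < Real.sqrt 2 * (Lf + 1) / η := by positivity
    refine ⟨_, fun x => Real.exp (Real.sqrt 2 * (Lf + 1) / η * x),
      strictConvexOn_exp_mul_div hK (convex_Icc 0 1),
      fun p _ q _ => exp_mul_div_add_le hK p q, fun f hf hlip p hp hopt => ?_⟩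
    have h := mul_abs_sub_le_of_exp_optimal hK hLf hf hlip hp hopt
    rw [div_mul_eq_mul_div, div_le_iff₀ hη] at h
    refine le_of_mul_le_mul_left ?_ (by linarith : 0 < Lf + 1)
    linarith
  refine ⟨main ε hε, fun hL1 => ?_⟩
  have hL : 0 < 1 - Lf := sub_pos.2 hL1
  obtain ⟨G, g, hG, hg, h⟩ := main (ε * (1 - Lf)) (mul_pos hε hL)
  refine ⟨G, g, hG, hg, fun f hf hlip p hp hopt s hs hfix => ?_⟩
  have h1 := h f hf hlip p hp hopt
  have h2 := hlip p hp s hs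
  rw [hfix] at h2
  have h3 : (1 - Lf) * |p - s| ≤ |p - f p| := by
    linarith [abs_sub_le p (f p) s]
  refine le_of_mul_le_mul_right ?_ hL
  calc Real.sqrt 2 * |p - s| * (1 - Lf) = Real.sqrt 2 * ((1 - Lf) * |p - s|) := by ring
    _ ≤ Real.sqrt 2 * |p - f p| := by gcongr
    _ ≤ ε * (1 - Lf) := h1
end

section
/- In the binary case, let S be a proper scoring rule defined via g, let ε > 0 and L > 0, and assume S has the property that for every f : [0,1] → [0,1] with Lipschitz constant L, every performatively optimal report p satisfies |p − f(p)| ≤ ε. Set δ := ε/(L+1). Then for every interval of width 2δ contained in [0, 1 − 3ε + 2δ], there exists a point p in that interval such that p + 2δ ≤ 1 and g(p + 2δ) − g(p) ≥ (2L/(L+3)) · g(p). -/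
open Set

/-- A subgradient of a function on `[0,1]` is monotone. -/
theorem monotoneOn_of_subgradient {G g : ℝ → ℝ}
    (hsub : ∀ p ∈ Icc (0:ℝ) 1, ∀ q ∈ Icc (0:ℝ) 1, G p + g p * (q - p) ≤ G q) :
    MonotoneOn g (Icc (0:ℝ) 1) := by
  intro x hx y hy hxy
  rcases hxy.eq_or_lt with rfl | hlt
  · exact le_rfl
  have h₁ := hsub x hx y hy
  have h₂ := hsub y hy x hx
  have h₃ : 0 ≤ (g y - g x) * (y - x) := by linarith
  have := nonneg_of_mul_nonneg_left h₃ (sub_pos.2 hlt)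
  linarith

/-- If performatively optimal reports are always `ε`-close to their fixed-point value, then `g`
has to grow on a short interval to the right of `p`. Otherwise `p` would be optimal for the
function that is `p + (L + 1) * d` up to `p`, then decreases with slope `-L` until it meets the
diagonal at `p + d`, and is constant afterwards. -/
theorem exists_subgradient_growth {G g : ℝ → ℝ}
    (hsub : ∀ p ∈ Icc (0:ℝ) 1, ∀ q ∈ Icc (0:ℝ) 1, G p + g p * (q - p) ≤ G q)
    {ε L : ℝ} (hL : 0 < L)
    (hprop : ∀ f : ℝ → ℝ, (∀ x ∈ Icc (0:ℝ) 1, f x ∈ Icc (0:ℝ) 1) →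
      (∀ x ∈ Icc (0:ℝ) 1, ∀ y ∈ Icc (0:ℝ) 1, |f x - f y| ≤ L * |x - y|) →
      ∀ p ∈ Icc (0:ℝ) 1,
        (∀ x ∈ Icc (0:ℝ) 1, g x * (f x - x) + G x ≤ g p * (f p - p) + G p) →
        |p - f p| ≤ ε)
    {p d : ℝ} (hp : 0 ≤ p) (hd : 0 < d) (hpd : p + (L + 1) * d ≤ 1) (hεd : ε < (L + 1) * d) :
    ∃ t, 0 < t ∧ t ≤ d ∧ (L + 1) * d * g p < ((L + 1) * d - L * t) * g (p + t) := by
  have hLd : 0 < L * d := mul_pos hL hd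
  have hpI : p ∈ Icc (0:ℝ) 1 := ⟨hp, by linarith⟩
  by_contra! hno
  have key : ∀ t, 0 ≤ t → t ≤ d →
      g (p + t) * ((L + 1) * d - (L + 1) * t) + G (p + t) ≤ g p * ((L + 1) * d) + G p := by
    intro t ht htd
    rcases ht.eq_or_lt with rfl | hpos
    · simp
    have h₁ := hno t hpos htd
    have h₂ := hsub (p + t) ⟨by linarith, by linarith⟩ p hpI
    linarith
  set m : ℝ → ℝ := fun x => min (max (x - p) 0) d with hm
  have hm0 : ∀ x, 0 ≤ m x := fun x => le_min (le_max_right _ _) hd.le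
  have hmd : ∀ x, m x ≤ d := fun x => min_le_right _ _
  have hmlip : ∀ x y, |m x - m y| ≤ |x - y| := by
    intro x y
    calc |m x - m y| ≤ max |max (x - p) 0 - max (y - p) 0| |d - d| :=
          abs_min_sub_min_le_max _ _ _ _
      _ = |max (x - p) 0 - max (y - p) 0| := by simp
      _ ≤ max |(x - p) - (y - p)| |(0:ℝ) - 0| := abs_max_sub_max_le_max _ _ _ _
      _ = |x - y| := by simp
  have hmp : m p = 0 := by simp [hm, hd.le]
  have hopt := hprop (fun x => p + (L + 1) * d - L * m x) ?_ ?_ p hpI ?_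
  · simp only [hmp] at hopt
    have := (abs_le.1 hopt).1
    linarith
  · intro x _
    have h₁ := mul_le_mul_of_nonneg_left (hmd x) hL.le
    have h₂ := mul_nonneg hL.le (hm0 x)
    constructor <;> linarith
  · intro x _ y _
    have : p + (L + 1) * d - L * m x - (p + (L + 1) * d - L * m y) = L * -(m x - m y) := by ring
    rw [this, abs_mul, abs_neg, abs_of_pos hL]
    exact mul_le_mul_of_nonneg_left (hmlip x y) hL.le
  · intro x hx
    simp only [hmp]
    rcases le_total x p with hxp | hpx
    · have hmx : m x = 0 := by simp [hm, hxp, hd.le]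
      have hmono := monotoneOn_of_subgradient hsub hx hpI hxp
      have h₁ := hsub p hpI x hx
      have h₂ := hsub x hx p hpI
      have h₃ := mul_le_mul_of_nonneg_right hmono (show 0 ≤ (L + 1) * d by linarith)
      rw [hmx]
      linarith
    rcases le_total (x - p) d with hxd | hdx
    · have hmx : m x = x - p := by simp [hm, hpx, hxd]
      have h := key (x - p) (by linarith) hxd
      rw [add_sub_cancel] at h
      rw [hmx]
      linarith
    · have hmx : m x = d := by
        simp only [hm]
        rw [max_eq_left (by linarith), min_eq_right hdx]
      have h₁ := key d hd.le le_rfl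
      have h₂ := hsub x hx (p + d) ⟨by linarith, by linarith⟩
      rw [hmx]
      linarith

/-- For a function that is monotone on `[a,b]` there is a last point of `[a,b]` at which it dominates
the exponential of rate `k` started at `a`. -/
theorem exists_isGreatest_exp_le {g : ℝ → ℝ} {a b k : ℝ} (hab : a ≤ b)
    (hg : MonotoneOn g (Icc a b)) :
    ∃ s, IsGreatest {y ∈ Icc a b | g a * Real.exp (k * (y - a)) ≤ g y} s := by
  set A := {y ∈ Icc a b | g a * Real.exp (k * (y - a)) ≤ g y}
  have haA : a ∈ A := ⟨left_mem_Icc.2 hab, by simp⟩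
  have hbdd : BddAbove A := ⟨b, fun y hy => hy.1.2⟩
  have hsup : IsLUB A (sSup A) := isLUB_csSup ⟨a, haA⟩ hbdd
  have hsI : sSup A ∈ Icc a b := ⟨hsup.1 haA, hsup.2 fun y hy => hy.1.2⟩
  refine ⟨sSup A, ⟨hsI, ?_⟩, hsup.1⟩
  have hcont : Continuous fun y => g a * Real.exp (k * (y - a)) := by fun_prop
  refine (hsup.mem_closure ⟨a, haA⟩ |> closure_minimal (t := {y | g a * Real.exp (k * (y - a)) ≤
    g (sSup A)}) ?_ (isClosed_le hcont continuous_const))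
  exact fun y hy => hy.2.trans (hg hy.1 hsI (hsup.1 hy))

theorem one_le_mul_exp_six_fifths {u : ℝ} (h0 : 0 ≤ u) (h1 : u ≤ 1) :
    1 ≤ (1 - 2 * u / 3) * Real.exp (6 * u / 5) := by
  have h := Real.quadratic_le_exp_of_nonneg (show 0 ≤ 3 * u / 5 by positivity)
  have hsq : Real.exp (6 * u / 5) = Real.exp (3 * u / 5) ^ 2 := by
    rw [← Real.exp_nat_mul]; congr 1; push_cast; ring
  have h₂ : (1 + 3 * u / 5 + (3 * u / 5) ^ 2 / 2) ^ 2 ≤ Real.exp (3 * u / 5) ^ 2 := by gcongr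
  have h₃ : 1 + 6 * u / 5 + 18 * u ^ 2 / 25 + 27 * u ^ 3 / 125 ≤ Real.exp (6 * u / 5) := by
    rw [hsq]
    nlinarith [pow_nonneg h0 4]
  refine le_trans ?_ (mul_le_mul_of_nonneg_left h₃ (by linarith))
  have : 0 ≤ u * (1 - u) := mul_nonneg h0 (by linarith)
  have : 0 ≤ u * (1 - u) * u := mul_nonneg this h0
  have : 0 ≤ u * (1 - u) * u * u := mul_nonneg this h0
  nlinarith

theorem one_le_mul_exp {u : ℝ} (h0 : 0 ≤ u) (h1 : u ≤ 1 / 2) :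
    1 ≤ (1 - 2 * u / 3) * Real.exp u := by
  refine le_trans ?_ (mul_le_mul_of_nonneg_left (Real.add_one_le_exp u) (by linarith))
  nlinarith

/-- (Binary case.) Let `S(p,q) = g p * (q - p) + G p` be a proper scoring
rule (`G` convex on `[0,1]`, `g` a subgradient), let `ε, L > 0`, and suppose that for every
`f : [0,1] → [0,1]` with Lipschitz constant `L`, every performatively optimal report `p`
satisfies `|p − f p| ≤ ε`. Set `δ := ε/(L+1)`. Then every interval `[c, c+2δ]` contained in
`[0, 1 − 3ε + 2δ]` contains a point `p` with `p + 2δ ≤ 1` and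
`g(p + 2δ) − g(p) ≥ (2L/(L+3)) · g(p)`. -/
theorem stmt9 (G g : ℝ → ℝ)
    (hconv : ConvexOn ℝ (Icc (0:ℝ) 1) G)
    (hsub : ∀ p ∈ Icc (0:ℝ) 1, ∀ q ∈ Icc (0:ℝ) 1, G p + g p * (q - p) ≤ G q)
    (ε L : ℝ) (hε : 0 < ε) (hL : 0 < L)
    (hprop : ∀ f : ℝ → ℝ, (∀ x ∈ Icc (0:ℝ) 1, f x ∈ Icc (0:ℝ) 1) →
      (∀ x ∈ Icc (0:ℝ) 1, ∀ y ∈ Icc (0:ℝ) 1, |f x - f y| ≤ L * |x - y|) →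
      ∀ p ∈ Icc (0:ℝ) 1,
        (∀ x ∈ Icc (0:ℝ) 1, g x * (f x - x) + G x ≤ g p * (f p - p) + G p) →
        |p - f p| ≤ ε)
    (δ : ℝ) (hδ : δ = ε / (L + 1))
    (c : ℝ) (hc : 0 ≤ c) (hcd : c + 2 * δ ≤ 1 - 3 * ε + 2 * δ) :
    ∃ p ∈ Icc c (c + 2 * δ), p + 2 * δ ≤ 1 ∧
      (2 * L / (L + 3)) * g p ≤ g (p + 2 * δ) - g p := by
  have hL1 : 0 < L + 1 := by linarith
  have hδ0 : 0 < δ := by rw [hδ]; positivity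
  have hεδ : ε = (L + 1) * δ := by rw [hδ]; field_simp
  have hLδ : 0 < L * δ := mul_pos hL hδ0
  have hmono := monotoneOn_of_subgradient hsub
  have hc2 : c + 2 * δ ≤ 1 := by linarith
  rcases le_or_gt (g c) 0 with hgc | hgc
  · refine ⟨c, ⟨le_rfl, by linarith⟩, hc2, ?_⟩
    have h₁ := hmono ⟨hc, by linarith⟩ ⟨by linarith, hc2⟩ (show c ≤ c + 2 * δ by linarith)
    have h₂ : 2 * L / (L + 3) * g c ≤ 0 := mul_nonpos_of_nonneg_of_nonpos (by positivity) hgc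
    linarith
  obtain ⟨u, hu⟩ : ∃ u, u = L / (L + 1) := ⟨_, rfl⟩
  have hu0 : 0 < u := by rw [hu]; positivity
  have huL : (L + 1) * u = L := by rw [hu]; field_simp
  have hu1 : u < 1 := by nlinarith
  have huleL : u ≤ L := by nlinarith
  -- The growth factor in the claim is `3 / (3 - 2 * u)`.
  have hfactor : ∀ a b : ℝ, a ≤ (1 - 2 * u / 3) * b → 2 * L / (L + 3) * a ≤ b - a := by
    intro a b hab
    have h₁ : (L + 1) * a ≤ (L + 1) * ((1 - 2 * u / 3) * b) :=
      mul_le_mul_of_nonneg_left hab hL1.le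
    have h₂ : (L + 1) * ((1 - 2 * u / 3) * b) = (L + 1 - 2 * L / 3) * b := by
      linear_combination (-(2 * b / 3)) * huL
    rw [div_mul_eq_mul_div, div_le_iff₀ (by linarith)]
    linarith
  -- A radius slightly larger than `δ`.
  obtain ⟨d, hd⟩ : ∃ d, d = δ * (1 + u / 14) := ⟨_, rfl⟩
  have huδ : 0 < δ * u := mul_pos hδ0 hu0
  have hδd : δ < d := by linarith
  have hd0 : 0 < d := by linarith
  have hdδ : d ≤ δ * (15 / 14) := by
    rw [hd]; exact mul_le_mul_of_nonneg_left (by linarith) hδ0.le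
  have hdδL : d ≤ δ * (3 * L + 1) := by
    rw [hd]; exact mul_le_mul_of_nonneg_left (by linarith) hδ0.le
  have hLd : (L + 1) * d = (L + 1) * δ + L * δ / 14 := by
    rw [hd]; linear_combination (δ / 14) * huL
  have hk : 0 ≤ u / d := by positivity
  obtain ⟨s, ⟨⟨hcs, hs2⟩, hgs⟩, hmax⟩ := exists_isGreatest_exp_le (show c ≤ c + 2 * δ by linarith)
    (k := u / d) (hmono.mono (Icc_subset_Icc hc hc2))
  have hs1 : s ≤ 1 := by linarith
  have hsI : s ∈ Icc (0:ℝ) 1 := ⟨by linarith, hs1⟩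
  have hgs0 : 0 < g s := lt_of_lt_of_le (by positivity) hgs
  obtain ⟨t, ht0, htd, ht⟩ := exists_subgradient_growth hsub hL hprop hsI.1 hd0
    (by linarith) (by linarith)
  have hst1 : s + t ≤ 1 := by linarith
  have hstI : s + t ∈ Icc (0:ℝ) 1 := ⟨by linarith, hst1⟩
  have hgst : g s ≤ g (s + t) := hmono hsI hstI (by linarith)
  have hgst' : g s ≤ (1 - u / d * t) * g (s + t) := by
    have h : (L + 1) * d * ((1 - u / d * t) * g (s + t)) = ((L + 1) * d - L * t) * g (s + t) := by
      linear_combination (-((L + 1) * t * g (s + t))) * div_mul_cancel₀ u hd0.ne' -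
        t * g (s + t) * huL
    exact (lt_of_mul_lt_mul_left (h ▸ ht) (by positivity)).le
  -- Enough exponential growth between `c` and `s` makes `c` a witness.
  have hfar : ∀ w, 1 ≤ (1 - 2 * u / 3) * Real.exp w → w ≤ u / d * (s - c) →
      ∃ p ∈ Icc c (c + 2 * δ), p + 2 * δ ≤ 1 ∧
        (2 * L / (L + 3)) * g p ≤ g (p + 2 * δ) - g p := by
    intro w hw hws
    refine ⟨c, ⟨le_rfl, by linarith⟩, hc2, hfactor _ _ ?_⟩
    have h₁ : g s ≤ g (c + 2 * δ) := hmono hsI ⟨by linarith, hc2⟩ hs2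
    have h₂ : Real.exp w ≤ Real.exp (u / d * (s - c)) := Real.exp_le_exp.2 hws
    have hpos : 0 ≤ 1 - 2 * u / 3 := by linarith
    calc g c = g c * 1 := (mul_one _).symm
      _ ≤ g c * ((1 - 2 * u / 3) * Real.exp w) := by gcongr
      _ ≤ g c * ((1 - 2 * u / 3) * Real.exp (u / d * (s - c))) := by gcongr
      _ = (1 - 2 * u / 3) * (g c * Real.exp (u / d * (s - c))) := by ring
      _ ≤ (1 - 2 * u / 3) * g (c + 2 * δ) := by
        gcongr
        exact hgs.trans h₁
  rcases le_or_gt (2 / 3 * d) t with hlong | hshort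
  · rcases le_or_gt (s + 2 * δ) 1 with hs | hs
    · refine ⟨s, ⟨hcs, hs2⟩, hs, hfactor _ _ ?_⟩
      have h₁ : g (s + t) ≤ g (s + 2 * δ) := hmono hstI ⟨by linarith, hs⟩ (by linarith)
      have h₂ : 2 * u / 3 ≤ u / d * t := by
        have := mul_le_mul_of_nonneg_left hlong hk
        have h₃ : u / d * (2 / 3 * d) = 2 * u / 3 := by field_simp
        linarith
      calc g s ≤ (1 - u / d * t) * g (s + t) := hgst'
        _ ≤ (1 - 2 * u / 3) * g (s + t) := by
          apply mul_le_mul_of_nonneg_right _ (by linarith)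
          linarith
        _ ≤ (1 - 2 * u / 3) * g (s + 2 * δ) := mul_le_mul_of_nonneg_left h₁ (by linarith)
    · have hL3 : L < 1 / 3 := by
        by_contra! hcon
        have := mul_le_mul_of_nonneg_right hcon hδ0.le
        linarith
      refine hfar u (one_le_mul_exp hu0.le (by linarith)) ?_
      have h := mul_le_mul_of_nonneg_left (show d ≤ s - c by linarith) hk
      rwa [div_mul_cancel₀ _ hd0.ne'] at h
  · refine hfar (6 * u / 5) (one_le_mul_exp_six_fifths hu0.le hu1.le) ?_
    have hbeyond : c + 2 * δ < s + t := by
      by_contra! hcon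
      have hmem : s + t ≤ s := by
        refine hmax ⟨⟨by linarith, hcon⟩, ?_⟩
        have h₁ : 1 - u / d * t ≤ Real.exp (-(u / d * t)) := Real.one_sub_le_exp_neg _
        calc g c * Real.exp (u / d * (s + t - c))
            = g c * Real.exp (u / d * (s - c)) * Real.exp (u / d * t) := by
              rw [mul_assoc, ← Real.exp_add]; ring_nf
          _ ≤ g s * Real.exp (u / d * t) := by gcongr
          _ ≤ Real.exp (-(u / d * t)) * g (s + t) * Real.exp (u / d * t) := by
              gcongr
              exact hgst'.trans (mul_le_mul_of_nonneg_right h₁ (by linarith))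
          _ = g (s + t) := by
              rw [mul_right_comm, ← Real.exp_add]; simp
      linarith
    have h := mul_le_mul_of_nonneg_left (show 6 / 5 * d ≤ s - c by linarith) hk
    have h₃ : u / d * (6 / 5 * d) = 6 * u / 5 := by field_simp
    linarith
end

section
/- In the binary case, suppose S is a proper scoring rule defined via g such that for some ε, L_f > 0, whenever f : [0,1] → [0,1] is L_f-Lipschitz, every performatively optimal report p satisfies |f(p) − p| ≤ ε. Let δ := ε/(L_f + 1) and let p_l, p_h satisfy 3ε − 3δ ≤ p_l ≤ p_h ≤ 1 − 3ε − δ. Then (sup_{x ∈ [p_l, p_h]} |g(x + 4δ) − g(x)|) / (inf_{x ∈ [p_l, p_h]} |g(x + 4δ) − g(x)|) ≥ (2L_f/(L_f + 3)) · (3(L_f + 1)/(L_f + 3))^{(L_f + 1)(p_h − p_l)/(8ε) − 5/2}. -/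
open Set

/-- `g` is a subgradient of `G` on `[0,1]`, and for every `L`-Lipschitz self-map of `[0,1]` each
performatively optimal report is within `ε` of being a fixed point. -/
def IsApproxHonest (G g : ℝ → ℝ) (ε L : ℝ) : Prop :=
  (∀ p ∈ Icc (0:ℝ) 1, ∀ q ∈ Icc (0:ℝ) 1, G p + g p * (q - p) ≤ G q) ∧
  ∀ f : ℝ → ℝ, (∀ x ∈ Icc (0:ℝ) 1, f x ∈ Icc (0:ℝ) 1) →
    (∀ x ∈ Icc (0:ℝ) 1, ∀ y ∈ Icc (0:ℝ) 1, |f x - f y| ≤ L * |x - y|) →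
    ∀ p ∈ Icc (0:ℝ) 1,
      (∀ x ∈ Icc (0:ℝ) 1, g x * (f x - x) + G x ≤ g p * (f p - p) + G p) →
      |f p - p| ≤ ε

namespace IsApproxHonest

variable {G g : ℝ → ℝ} {ε L : ℝ}

lemma monotoneOn (h : IsApproxHonest G g ε L) : MonotoneOn g (Icc 0 1) := by
  intro p hp q hq hpq
  rcases hpq.eq_or_lt with rfl | hlt
  · exact le_rfl
  · have h1 := h.1 p hp q hq
    have h2 := h.1 q hq p hp
    by_contra! hgt
    nlinarith [mul_pos (sub_pos.2 hgt) (sub_pos.2 hlt)]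

/-- Exchanging the roles of the two outcomes. -/
lemma reflect (h : IsApproxHonest G g ε L) :
    IsApproxHonest (fun x => G (1 - x)) (fun x => -g (1 - x)) ε L := by
  have refl_mem : ∀ {x : ℝ}, x ∈ Icc (0:ℝ) 1 → 1 - x ∈ Icc (0:ℝ) 1 := fun hx =>
    ⟨by linarith [hx.2], by linarith [hx.1]⟩
  refine ⟨fun p hp q hq => ?_, fun f hf hlip p hp hopt => ?_⟩
  · have := h.1 (1 - p) (refl_mem hp) (1 - q) (refl_mem hq)
    linarith
  · have key := h.2 (fun x => 1 - f (1 - x)) (fun x hx => refl_mem (hf _ (refl_mem hx)))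
      (fun x hx y hy => ?_) (1 - p) (refl_mem hp) (fun x hx => ?_)
    · rw [abs_sub_comm]
      simpa using key
    · have := hlip _ (refl_mem hy) _ (refl_mem hx)
      rw [show 1 - f (1 - x) - (1 - f (1 - y)) = f (1 - y) - f (1 - x) by ring]
      rwa [show 1 - y - (1 - x) = x - y by ring] at this
    · have := hopt (1 - x) (refl_mem hx)
      simp only [sub_sub_cancel] at this ⊢
      linarith

/-- If `f` is a tent of height `e` over its base level `p`, peaked at `p`, then `p` is not
performatively optimal, and any better report forces `g` to grow right after `p`. -/
lemma exists_growth (h : IsApproxHonest G g ε L) (hL : 0 < L) {p e : ℝ} (hp : 0 ≤ p)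
    (hgp : 0 ≤ g p) (he : 0 < e) (hεe : ε < e) (hpe : p + e ≤ 1) :
    ∃ t, 0 < t ∧ t ≤ e / (L + 1) ∧ p + t ≤ 1 ∧ g p * e < g (p + t) * (e - L * t) := by
  set f : ℝ → ℝ := fun y => max (p + e - L * |y - p|) p with hf
  have hp' : p ∈ Icc (0:ℝ) 1 := ⟨hp, by linarith⟩
  have hfp : f p = p + e := by simp [hf, he.le]
  have hfle : ∀ y, f y ≤ p + e := fun y =>
    max_le (by nlinarith [abs_nonneg (y - p)]) (by linarith)
  have hpf : ∀ y, p ≤ f y := fun y => le_max_right _ _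
  have hbetter : ∃ y ∈ Icc (0:ℝ) 1, g p * (f p - p) + G p < g y * (f y - y) + G y := by
    by_contra! hopt
    have := h.2 f (fun y _ => ⟨hp.trans (hpf y), (hfle y).trans hpe⟩) (fun x _ y _ => ?_) p hp' hopt
    · rw [hfp, add_sub_cancel_left, abs_of_pos he] at this
      linarith
    · calc |f x - f y| ≤ |(p + e - L * |x - p|) - (p + e - L * |y - p|)| :=
            abs_max_sub_max_le_abs _ _ _
        _ = L * |(|y - p| - |x - p|)| := by
            rw [show (p + e - L * |x - p|) - (p + e - L * |y - p|) = L * (|y - p| - |x - p|) by ring,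
              abs_mul, abs_of_pos hL]
        _ ≤ L * |x - y| := by
            refine mul_le_mul_of_nonneg_left ?_ hL.le
            rw [abs_sub_comm x y]
            simpa using abs_abs_sub_abs_le (y - p) (x - p)
  obtain ⟨y, hy, hlt⟩ := hbetter
  rw [hfp, add_sub_cancel_left] at hlt
  have hsub := h.1 y hy p hp'
  have hlt' : g p * e < g y * (f y - p) := by linarith
  have hpy : p < y := by
    by_contra! hyp
    have hg := h.monotoneOn hy hp' hyp
    nlinarith [mul_nonneg (sub_nonneg.2 hg) (sub_nonneg.2 (hpf y)),
      mul_nonneg hgp (sub_nonneg.2 (hfle y))]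
  have hgy : 0 ≤ g y := hgp.trans (h.monotoneOn hp' hy hpy.le)
  have hfy : f y = p + e - L * (y - p) := by
    have hne : f y ≠ p := by
      intro hyp
      rw [hyp, sub_self, mul_zero] at hlt'
      exact absurd hlt' (not_lt.2 (mul_nonneg hgp he.le))
    rcases max_choice (p + e - L * |y - p|) p with hm | hm
    · rw [← abs_of_pos (sub_pos.2 hpy)]; exact hm
    · exact absurd hm hne
  by_cases ht : y - p ≤ e / (L + 1)
  · refine ⟨y - p, sub_pos.2 hpy, ht, by linarith [hy.2], ?_⟩
    rw [add_sub_cancel]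
    rw [hfy] at hlt'
    linarith
  · push Not at ht
    set d := e / (L + 1) with hd
    have hde : e = d * (L + 1) := by rw [hd]; field_simp
    have hd0 : 0 < d := by positivity
    refine ⟨d, hd0, le_rfl, by linarith [hy.2], ?_⟩
    have hmem : p + d ∈ Icc (0:ℝ) 1 := ⟨by linarith, by linarith [hy.2]⟩
    have h1 := h.1 y hy _ hmem
    have h2 := h.1 _ hmem p hp'
    rw [hfy] at hlt
    have h3 : 0 ≤ L * g y * (y - p - d) :=
      mul_nonneg (mul_nonneg hL.le hgy) (by linarith)
    rw [show e - L * d = d by rw [hde]; ring]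
    have h4 : g y * (p + e - L * (y - p) - y) = - (L * g y * (y - p - d)) - g y * (y - p - d) := by
      rw [hde]; ring
    linarith

variable {δ : ℝ}

/-- A nonnegative `g` grows at least by the factor `(3L+2)/(L+2)` over a distance `4δ`. -/
lemma mul_le_mul_add_four (h : IsApproxHonest G g ((L + 1) * δ) L) (hL : 0 < L) (hδ : 0 < δ)
    {x : ℝ} (hx : 0 ≤ x) (hx1 : x + 4 * δ + 3 * L * δ ≤ 1) (hgx : 0 ≤ g x) :
    (3 * L + 2) * g x ≤ (L + 2) * g (x + 4 * δ) := by
  have hLδ : 0 < L * δ := mul_pos hL hδ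
  set e := (L + 2) * δ with he
  have he0 : 0 < e := by positivity
  have hx' : x ∈ Icc (0:ℝ) 1 := ⟨hx, by linarith⟩
  set A : Set ℝ := {q | q ∈ Icc x (x + 2 * δ) ∧ g x * (e + L * (q - x)) ≤ g q * e} with hA
  have hxA : x ∈ A := ⟨⟨le_rfl, by linarith⟩, by simp⟩
  have hbdd : BddAbove A := ⟨x + 2 * δ, fun q hq => hq.1.2⟩
  set s := sSup A with hs
  have hxs : x ≤ s := le_csSup hbdd hxA
  have hs2 : s ≤ x + 2 * δ := csSup_le ⟨x, hxA⟩ fun q hq => hq.1.2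
  have hs' : s ∈ Icc (0:ℝ) 1 := ⟨by linarith, by linarith⟩
  have hgxs : g x ≤ g s := h.monotoneOn hx' hs' hxs
  have hsA : g x * (e + L * (s - x)) ≤ g s * e := by
    rcases hgx.eq_or_lt with h0 | hpos
    · rw [← h0, zero_mul]
      exact mul_nonneg (hgx.trans hgxs) he0.le
    · have : s ≤ x + (g s * e / g x - e) / L := by
        refine csSup_le ⟨x, hxA⟩ fun q hq => ?_
        have hgq : g q ≤ g s := h.monotoneOn ⟨by linarith [hq.1.1], by linarith [hq.1.2]⟩ hs'
          (le_csSup hbdd hq)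
        have h1 : g x * (e + L * (q - x)) ≤ g s * e :=
          hq.2.trans (mul_le_mul_of_nonneg_right hgq he0.le)
        rw [← sub_le_iff_le_add', le_div_iff₀ hL, le_sub_iff_add_le, le_div_iff₀ hpos]
        linarith
      rw [← sub_le_iff_le_add', le_div_iff₀ hL, le_sub_iff_add_le, le_div_iff₀ hpos] at this
      linarith
  obtain ⟨t, ht0, ht, ht1, hgt⟩ := h.exists_growth hL hs'.1 (hgx.trans hgxs) he0
    (by rw [he]; nlinarith) (by rw [he]; nlinarith)
  have hq' : s + t ∈ Icc (0:ℝ) 1 := ⟨by linarith, ht1⟩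
  have hgq : 0 ≤ g (s + t) := (hgx.trans hgxs).trans (h.monotoneOn hs' hq' (by linarith))
  have hstep : g x * (e + L * (s + t - x)) ≤ g (s + t) * e := by
    have h1 : g s * e * (e + L * t) ≤ g (s + t) * (e - L * t) * (e + L * t) :=
      mul_le_mul_of_nonneg_right hgt.le (by positivity)
    have h2 : g x * (e + L * (s - x)) * (e + L * t) ≤ g s * e * (e + L * t) :=
      mul_le_mul_of_nonneg_right hsA (by positivity)
    have h3 : 0 ≤ g (s + t) * (L * t) ^ 2 := by positivity
    have h4 : 0 ≤ g x * (L * (s - x) * (L * t)) :=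
      mul_nonneg hgx (mul_nonneg (mul_nonneg hL.le (by linarith)) (by positivity))
    refine le_of_mul_le_mul_right ?_ he0
    linarith
  have hgap : x + 2 * δ < s + t := by
    by_contra! hle
    have := le_csSup hbdd (show s + t ∈ A from ⟨⟨by linarith, hle⟩, hstep⟩)
    linarith
  have ht2 : t ≤ 2 * δ := by
    refine ht.trans ?_
    rw [div_le_iff₀ (by linarith), he]
    nlinarith
  have hend : g (s + t) ≤ g (x + 4 * δ) :=
    h.monotoneOn hq' ⟨by linarith, by linarith⟩ (by linarith)
  have h5 : g x * (e + L * (2 * δ)) ≤ g (x + 4 * δ) * e :=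
    calc g x * (e + L * (2 * δ)) ≤ g x * (e + L * (s + t - x)) := by gcongr; linarith
      _ ≤ g (s + t) * e := hstep
      _ ≤ g (x + 4 * δ) * e := by gcongr
  refine le_of_mul_le_mul_right ?_ hδ
  rw [he] at h5
  linarith

lemma const_mul_le (h : IsApproxHonest G g ((L + 1) * δ) L) (hL : 0 < L) (hδ : 0 < δ)
    {x : ℝ} (hx : 0 ≤ x) (hx1 : x + 4 * δ + 3 * L * δ ≤ 1) (hgx : 0 ≤ g x) :
    3 * (L + 1) / (L + 3) * g x ≤ g (x + 4 * δ) := by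
  have h1 := h.mul_le_mul_add_four hL hδ hx hx1 hgx
  have h2 : 3 * (L + 1) / (L + 3) ≤ (3 * L + 2) / (L + 2) := by
    rw [div_le_div_iff₀ (by linarith) (by linarith)]
    nlinarith
  calc 3 * (L + 1) / (L + 3) * g x ≤ (3 * L + 2) / (L + 2) * g x := by gcongr
    _ = (3 * L + 2) * g x / (L + 2) := by ring
    _ ≤ g (x + 4 * δ) := by
      rw [div_le_iff₀ (by linarith)]
      linarith

/-- The increments of `g` over `4δ` are bounded away from zero on the right half. -/
lemma exists_pos_le_increment (h : IsApproxHonest G g ((L + 1) * δ) L) (hL : 0 < L) (hδ : 0 < δ)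
    {pl ph : ℝ} (hpl : 0 ≤ pl) (hph : ph + 4 * δ + 3 * L * δ ≤ 1) :
    ∃ v, 0 < v ∧ ∀ x ∈ Icc pl ph, 0 ≤ g (x + 2 * δ) → v ≤ g (x + 4 * δ) - g x := by
  have hLδ : 0 < L * δ := mul_pos hL hδ
  set B : Set ℝ := {x | x ∈ Icc pl ph ∧ 0 ≤ g (x + 2 * δ)} with hB
  rcases B.eq_empty_or_nonempty with hemp | hne
  · refine ⟨1, one_pos, fun x hx hgx => ?_⟩
    have : x ∈ B := ⟨hx, hgx⟩
    rw [hemp] at this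
    exact this.elim
  set e := (L + 2) * δ with he
  have he0 : 0 < e := by positivity
  have hd : e / (L + 1) < 2 * δ := by
    rw [div_lt_iff₀ (by linarith), he]
    nlinarith
  have hbdd : BddBelow B := ⟨pl, fun x hx => hx.1.1⟩
  obtain ⟨z, hz, hzlt⟩ := exists_lt_of_csInf_lt hne
    (show sInf B < sInf B + (2 * δ - e / (L + 1)) by linarith)
  have hzpl := hz.1.1
  have hzph := hz.1.2
  obtain ⟨t, ht0, ht, ht1, hgt⟩ := h.exists_growth hL (p := z + 2 * δ) (by linarith) hz.2 he0
    (by rw [he]; nlinarith) (by rw [he]; nlinarith)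
  set w := g (z + 2 * δ + t) with hw
  have hw0 : 0 < w := by
    have h1 : 0 < w * (e - L * t) := (mul_nonneg hz.2 he0.le).trans_lt hgt
    have h2 : 0 < e - L * t := by
      rw [le_div_iff₀ (by linarith)] at ht
      linarith
    exact pos_of_mul_pos_left h1 h2.le
  refine ⟨2 * L / (3 * (L + 1)) * w, by positivity, fun x hx hgx => ?_⟩
  have hinf : sInf B ≤ x := csInf_le hbdd ⟨hx, hgx⟩
  have hxpl := hx.1
  have hxph := hx.2
  have hwx : w ≤ g (x + 4 * δ) :=
    h.monotoneOn ⟨by linarith, ht1⟩ ⟨by linarith, by linarith⟩ (by linarith)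
  rw [div_mul_eq_mul_div, div_le_iff₀ (by linarith)]
  rcases le_total (g x) 0 with hneg | hpos
  · nlinarith
  · have h3 := h.const_mul_le hL hδ (hpl.trans hxpl) (by linarith) hpos
    rw [div_mul_eq_mul_div, div_le_iff₀ (by linarith)] at h3
    nlinarith

lemma pow_mul_le (h : IsApproxHonest G g ((L + 1) * δ) L) (hL : 0 < L) (hδ : 0 < δ)
    {x : ℝ} (hx : 0 ≤ x) (hgx : 0 ≤ g x) (n : ℕ) (hn : x + 4 * δ * n + 3 * L * δ ≤ 1) :
    (3 * (L + 1) / (L + 3)) ^ n * g x ≤ g (x + 4 * δ * n) := by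
  have hLδ : 0 < L * δ := mul_pos hL hδ
  induction n with
  | zero => simp
  | succ n ih =>
    push_cast at hn ⊢
    have hn0 : 0 ≤ δ * n := by positivity
    have ih' := ih (by linarith)
    have hmem : x + 4 * δ * n ∈ Icc (0:ℝ) 1 := ⟨by linarith, by linarith⟩
    have hg0 : 0 ≤ g (x + 4 * δ * n) :=
      hgx.trans (h.monotoneOn ⟨hx, by linarith⟩ hmem (by linarith))
    calc (3 * (L + 1) / (L + 3)) ^ (n + 1) * g x
        = 3 * (L + 1) / (L + 3) * ((3 * (L + 1) / (L + 3)) ^ n * g x) := by ring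
      _ ≤ 3 * (L + 1) / (L + 3) * g (x + 4 * δ * n) := by gcongr
      _ ≤ g (x + 4 * δ * n + 4 * δ) := h.const_mul_le hL hδ hmem.1 (by linarith) hg0
      _ = g (x + 4 * δ * (n + 1)) := by ring_nf

/-- Two increments of `g` whose ratio is exponential in the length of the right half. -/
lemma exists_increments_of_nonneg (h : IsApproxHonest G g ((L + 1) * δ) L) (hL : 0 < L)
    (hδ : 0 < δ) {pl ph : ℝ} (hpl : 0 ≤ pl) (hle : pl ≤ ph) (hph : ph + 4 * δ + 3 * L * δ ≤ 1)
    (hmid : 0 ≤ g ((pl + ph) / 2 + 2 * δ)) :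
    ∃ x ∈ Icc pl ph, ∃ y ∈ Icc pl ph,
      2 * L / (L + 3) * (3 * (L + 1) / (L + 3)) ^ ((ph - pl) / (8 * δ) - 5 / 2) *
        (g (x + 4 * δ) - g x) ≤ g (y + 4 * δ) - g y := by
  have hLδ : 0 < L * δ := mul_pos hL hδ
  set K := 3 * (L + 1) / (L + 3) with hK
  have hK1 : 2 * L / (L + 3) = K - 1 := by rw [hK]; field_simp; ring
  have hKgt : 1 < K := by
    have : 0 < 2 * L / (L + 3) := by positivity
    linarith
  rw [hK1]
  set N := (ph - pl) / (8 * δ) - 5 / 2 with hN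
  have hNδ : ph - pl = 8 * δ * (N + 5 / 2) := by rw [hN]; field_simp; ring
  rcases lt_or_ge N (-1) with hneg | hge
  · have hmem : pl ∈ Icc pl ph := ⟨le_rfl, hle⟩
    refine ⟨pl, hmem, pl, hmem, ?_⟩
    have hD : 0 ≤ g (pl + 4 * δ) - g pl := sub_nonneg.2 <|
      h.monotoneOn ⟨hpl, by linarith⟩ ⟨by linarith, by linarith⟩ (by linarith)
    refine mul_le_of_le_one_left hD ?_
    calc (K - 1) * K ^ N ≤ K * K ^ (-1 : ℝ) := by
          gcongr
          · linarith
          · exact hKgt.le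
      _ = 1 := by rw [Real.rpow_neg_one, mul_inv_cancel₀ (by linarith)]
  · set n := ⌊N + 1⌋₊ with hn
    have hn1 : (n : ℝ) ≤ N + 1 := Nat.floor_le (by linarith)
    have hn2 : N + 1 < n + 1 := Nat.lt_floor_add_one _
    set x := (pl + ph) / 2 + 2 * δ with hx
    have hnδ : δ * n ≤ δ * (N + 1) := by gcongr
    have hn0 : 0 ≤ δ * n := by positivity
    have hy : x + 4 * δ * (n + 1) ≤ ph := by rw [hx]; linarith
    have hxpl : pl ≤ x := by rw [hx]; linarith
    have hxK : 0 ≤ x + 4 * δ := by linarith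
    have hgx4 : g x ≤ g (x + 4 * δ) :=
      h.monotoneOn ⟨by linarith, by linarith⟩ ⟨by linarith, by linarith⟩ (by linarith)
    refine ⟨x, ⟨hxpl, by linarith⟩, x + 4 * δ * (n + 1), ⟨by linarith, hy⟩, ?_⟩
    have h1 := h.pow_mul_le hL hδ hxK (hmid.trans hgx4) n (by linarith)
    rw [show x + 4 * δ + 4 * δ * n = x + 4 * δ * (n + 1) by ring] at h1
    have h2 := h.const_mul_le hL hδ (x := x + 4 * δ * (n + 1)) (by linarith) (by linarith)
      (le_trans (mul_nonneg (by positivity) (hmid.trans hgx4)) h1)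
    calc (K - 1) * K ^ N * (g (x + 4 * δ) - g x)
        ≤ (K - 1) * K ^ (n : ℝ) * g (x + 4 * δ) := by
          have : K ^ N ≤ K ^ (n : ℝ) := Real.rpow_le_rpow_of_exponent_le hKgt.le (by linarith)
          have : 0 ≤ K - 1 := by linarith
          have : 0 ≤ g (x + 4 * δ) - g x := by linarith
          gcongr
          linarith
      _ = (K - 1) * (K ^ n * g (x + 4 * δ)) := by rw [Real.rpow_natCast]; ring
      _ ≤ (K - 1) * g (x + 4 * δ * (n + 1)) := by
          have : 0 ≤ K - 1 := by linarith
          gcongr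
      _ ≤ g (x + 4 * δ * (n + 1) + 4 * δ) - g (x + 4 * δ * (n + 1)) := by linarith

end IsApproxHonest

/-- (Binary case.) Suppose `S(p,q) = g p * (q - p) + G p` is a proper
scoring rule such that for some `ε, L_f > 0`, whenever `f : [0,1] → [0,1]` is
`L_f`-Lipschitz, every performatively optimal report `p` satisfies `|f p − p| ≤ ε`.
Let `δ := ε/(L_f + 1)` and `3ε − 3δ ≤ p_l ≤ p_h ≤ 1 − 3ε − δ`. Then
`sup_{x ∈ [p_l,p_h]} |g(x+4δ) − g(x)| / inf_{x ∈ [p_l,p_h]} |g(x+4δ) − g(x)|`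
is at least `(2L_f/(L_f+3)) · (3(L_f+1)/(L_f+3))^((L_f+1)(p_h−p_l)/(8ε) − 5/2)`. -/
theorem stmt12 (G g : ℝ → ℝ)
    (hconv : ConvexOn ℝ (Icc (0:ℝ) 1) G)
    (hsub : ∀ p ∈ Icc (0:ℝ) 1, ∀ q ∈ Icc (0:ℝ) 1, G p + g p * (q - p) ≤ G q)
    (ε Lf : ℝ) (hε : 0 < ε) (hLf : 0 < Lf)
    (hprop : ∀ f : ℝ → ℝ, (∀ x ∈ Icc (0:ℝ) 1, f x ∈ Icc (0:ℝ) 1) →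
      (∀ x ∈ Icc (0:ℝ) 1, ∀ y ∈ Icc (0:ℝ) 1, |f x - f y| ≤ Lf * |x - y|) →
      ∀ p ∈ Icc (0:ℝ) 1,
        (∀ x ∈ Icc (0:ℝ) 1, g x * (f x - x) + G x ≤ g p * (f p - p) + G p) →
        |f p - p| ≤ ε)
    (δ : ℝ) (hδ : δ = ε / (Lf + 1))
    (pl ph : ℝ) (h1 : 3 * ε - 3 * δ ≤ pl) (h2 : pl ≤ ph) (h3 : ph ≤ 1 - 3 * ε - δ) :
    2 * Lf / (Lf + 3) *
        (3 * (Lf + 1) / (Lf + 3)) ^ ((Lf + 1) * (ph - pl) / (8 * ε) - 5 / 2) ≤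
      sSup ((fun x => |g (x + 4 * δ) - g x|) '' Icc pl ph) /
        sInf ((fun x => |g (x + 4 * δ) - g x|) '' Icc pl ph) := by
  have hL1 : 0 < Lf + 1 := by linarith
  have hδ0 : 0 < δ := by rw [hδ]; positivity
  obtain rfl : ε = (Lf + 1) * δ := by rw [hδ]; field_simp
  have h : IsApproxHonest G g ((Lf + 1) * δ) Lf := ⟨hsub, hprop⟩
  have hLδ : 0 < Lf * δ := mul_pos hLf hδ0
  have hpl : 0 ≤ pl := by linarith
  have hph : ph + 4 * δ + 3 * Lf * δ ≤ 1 := by linarith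
  have hpl' : 0 ≤ 1 - ph - 4 * δ := by linarith
  have hph' : 1 - pl - 4 * δ + 4 * δ + 3 * Lf * δ ≤ 1 := by linarith
  have hexp : (Lf + 1) * (ph - pl) / (8 * ((Lf + 1) * δ)) = (ph - pl) / (8 * δ) := by
    field_simp
  rw [hexp]
  -- The reflected increment at `1 - x - 4δ` is the increment at `x`.
  have hrefl : ∀ x, -g (1 - (1 - x - 4 * δ + 4 * δ)) - -g (1 - (1 - x - 4 * δ)) =
      g (x + 4 * δ) - g x := fun x => by ring_nf
  obtain ⟨v, hv, hlow⟩ : ∃ v, 0 < v ∧ ∀ x ∈ Icc pl ph, v ≤ g (x + 4 * δ) - g x := by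
    obtain ⟨v, hv, hvx⟩ := h.exists_pos_le_increment hLf hδ0 hpl hph
    obtain ⟨w, hw, hwx⟩ := h.reflect.exists_pos_le_increment hLf hδ0 hpl' hph'
    refine ⟨min v w, lt_min hv hw, fun x hx => ?_⟩
    rcases le_total 0 (g (x + 2 * δ)) with hpos | hneg
    · exact (min_le_left _ _).trans (hvx x hx hpos)
    · have := hwx (1 - x - 4 * δ) ⟨by linarith [hx.2], by linarith [hx.1]⟩ (by
        rw [show 1 - (1 - x - 4 * δ + 2 * δ) = x + 2 * δ by ring]
        linarith)
      rw [hrefl] at this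
      exact (min_le_right _ _).trans this
  obtain ⟨x, hx, y, hy, hxy⟩ : ∃ x ∈ Icc pl ph, ∃ y ∈ Icc pl ph,
      2 * Lf / (Lf + 3) * (3 * (Lf + 1) / (Lf + 3)) ^ ((ph - pl) / (8 * δ) - 5 / 2) *
        (g (x + 4 * δ) - g x) ≤ g (y + 4 * δ) - g y := by
    rcases le_total 0 (g ((pl + ph) / 2 + 2 * δ)) with hpos | hneg
    · exact h.exists_increments_of_nonneg hLf hδ0 hpl h2 hph hpos
    · obtain ⟨x, hx, y, hy, hxy⟩ := h.reflect.exists_increments_of_nonneg hLf hδ0 hpl'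
        (show 1 - ph - 4 * δ ≤ 1 - pl - 4 * δ by linarith) hph' (by
          rw [show 1 - ((1 - ph - 4 * δ + (1 - pl - 4 * δ)) / 2 + 2 * δ) =
            (pl + ph) / 2 + 2 * δ by ring]
          linarith)
      refine ⟨1 - x - 4 * δ, ⟨by linarith [hx.2], by linarith [hx.1]⟩,
        1 - y - 4 * δ, ⟨by linarith [hy.2], by linarith [hy.1]⟩, ?_⟩
      rw [← hrefl, ← hrefl (1 - y - 4 * δ)]
      rw [show 1 - pl - 4 * δ - (1 - ph - 4 * δ) = ph - pl by ring] at hxy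
      simpa only [show ∀ z : ℝ, 1 - (1 - z - 4 * δ) - 4 * δ = z from fun z => by ring] using hxy
  set D : ℝ → ℝ := fun x => |g (x + 4 * δ) - g x| with hD
  have hDeq : ∀ x ∈ Icc pl ph, D x = g (x + 4 * δ) - g x := fun x hx =>
    abs_of_pos (hv.trans_le (hlow x hx))
  have hbelow : ∀ d ∈ D '' Icc pl ph, v ≤ d := by
    rintro _ ⟨z, hz, rfl⟩
    rw [hDeq z hz]
    exact hlow z hz
  have hinf : 0 < sInf (D '' Icc pl ph) :=
    hv.trans_le (le_csInf ⟨_, mem_image_of_mem D hx⟩ hbelow)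
  have hinfle : sInf (D '' Icc pl ph) ≤ D x := csInf_le ⟨v, hbelow⟩ (mem_image_of_mem D hx)
  have hbdd : BddAbove (D '' Icc pl ph) := by
    refine ⟨g 1 - g 0, ?_⟩
    rintro _ ⟨z, hz, rfl⟩
    have hz1 := hz.1
    have hz2 := hz.2
    have := h.monotoneOn (a := 0) (b := z) ⟨le_rfl, zero_le_one⟩ ⟨by linarith, by linarith⟩
      (by linarith)
    have := h.monotoneOn (a := z + 4 * δ) (b := 1) ⟨by linarith, by linarith⟩
      ⟨zero_le_one, le_rfl⟩ (by linarith)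
    rw [hDeq z hz]
    linarith
  have hsup : D y ≤ sSup (D '' Icc pl ph) := le_csSup hbdd (mem_image_of_mem D hy)
  rw [le_div_iff₀ hinf]
  rw [← hDeq x hx, ← hDeq y hy] at hxy
  refine le_trans ?_ (hxy.trans hsup)
  gcongr
end

section
/- In the binary case, suppose S is a proper scoring rule such that for some ε, L_f > 0, whenever f : [0,1] → [0,1] is L_f-Lipschitz, every performatively optimal report p satisfies |f(p) − p| ≤ ε. Let 3ε ≤ p_l ≤ p_h ≤ 1 − 4ε and δ := ε/(L_f + 1). Then the ratio of the supremum and the infimum over p ∈ [p_l, p_h] of |S(p + 4δ, p) − S(p, p)| is at least (L_f/(2L_f + 6)) · (3(L_f + 1)/(L_f + 3))^{(L_f + 1)(p_h − p_l)/(8ε) − 5/2}. -/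
open Set

/-- `G` has subgradient `g` on `[0,1]`, and for every `L`-Lipschitz `f : [0,1] → [0,1]` every
performatively optimal report `p` of the associated scoring rule satisfies `|f p - p| ≤ ε`. -/
structure IsRobustScore (G g : ℝ → ℝ) (ε L : ℝ) : Prop where
  sub : ∀ p ∈ Icc (0:ℝ) 1, ∀ q ∈ Icc (0:ℝ) 1, G p + g p * (q - p) ≤ G q
  robust : ∀ f : ℝ → ℝ, (∀ x ∈ Icc (0:ℝ) 1, f x ∈ Icc (0:ℝ) 1) →
    (∀ x ∈ Icc (0:ℝ) 1, ∀ y ∈ Icc (0:ℝ) 1, |f x - f y| ≤ L * |x - y|) →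
    ∀ p ∈ Icc (0:ℝ) 1,
      (∀ x ∈ Icc (0:ℝ) 1, g x * (f x - x) + G x ≤ g p * (f p - p) + G p) →
      |f p - p| ≤ ε

namespace IsRobustScore

variable {G g : ℝ → ℝ} {ε L : ℝ}

lemma mono (h : IsRobustScore G g ε L) {x y : ℝ} (hx : 0 ≤ x) (hxy : x ≤ y) (hy : y ≤ 1) :
    g x ≤ g y := by
  rcases hxy.eq_or_lt with rfl | hlt
  · rfl
  have a := h.sub x ⟨hx, by linarith⟩ y ⟨by linarith, hy⟩
  have b := h.sub y ⟨by linarith, hy⟩ x ⟨hx, by linarith⟩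
  have : 0 ≤ (g y - g x) * (y - x) := by linarith
  have := nonneg_of_mul_nonneg_left this (by linarith)
  linarith

/-- Exchanging the two outcomes preserves robustness. -/
lemma reflect (h : IsRobustScore G g ε L) :
    IsRobustScore (fun x => G (1 - x)) (fun x => -g (1 - x)) ε L := by
  have hI : ∀ {x : ℝ}, x ∈ Icc (0:ℝ) 1 → 1 - x ∈ Icc (0:ℝ) 1 := fun hx =>
    ⟨by linarith [hx.2], by linarith [hx.1]⟩
  refine ⟨fun p hp q hq => ?_, fun f hf hL p hp hopt => ?_⟩
  · have := h.sub (1 - p) (hI hp) (1 - q) (hI hq)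
    linarith
  · have := h.robust (fun x => 1 - f (1 - x)) (fun x hx => hI (hf _ (hI hx))) ?_ (1 - p) (hI hp) ?_
    · simp only [sub_sub_cancel] at this
      rw [abs_sub_comm] at this
      convert this using 2
      ring
    · intro x hx y hy
      have := hL _ (hI hy) _ (hI hx)
      rw [sub_sub_sub_cancel_left] at this ⊢
      exact this
    · intro x hx
      have := hopt (1 - x) (hI hx)
      simp only [sub_sub_cancel] at this ⊢
      linarith

/-- A report `y` that would move the outcome up to `y + ε'` must be beaten by some report `x > y`,
even if the outcome falls at the maximal rate `L` to the right of `y`. -/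
lemma exists_better (h : IsRobustScore G g ε L) (hL : 0 < L) (hε : 0 < ε) {ε' y : ℝ}
    (hε' : ε < ε') (hy : 0 ≤ y) (hy1 : y + ε' ≤ 1) (hg : 0 ≤ g y) :
    ∃ x, y < x ∧ x ≤ 1 ∧ G y + g y * ε' < G x + g x * (ε' - (L + 1) * (x - y)) := by
  by_contra! hcon
  have hyI : y ∈ Icc (0:ℝ) 1 := ⟨hy, by linarith⟩
  set f : ℝ → ℝ := fun x => max (y + ε' - L * max (x - y) 0) 0 with hf
  have hfy : f y = y + ε' := by
    simp only [hf, sub_self, max_self, mul_zero, sub_zero]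
    exact max_eq_left (by linarith)
  have := h.robust f ?_ ?_ y hyI ?_
  · rw [hfy, add_sub_cancel_left, abs_of_pos (by linarith)] at this
    linarith
  · intro x _
    refine ⟨le_max_right _ _, max_le ?_ zero_le_one⟩
    have : 0 ≤ L * max (x - y) 0 := by positivity
    linarith
  · intro a _ b _
    calc |f a - f b| ≤ |(y + ε' - L * max (a - y) 0) - (y + ε' - L * max (b - y) 0)| := by
          simp only [hf]
          exact abs_max_sub_max_le_abs _ _ _
      _ = L * |max (a - y) 0 - max (b - y) 0| := by
          rw [abs_sub_comm, ← abs_of_pos hL, ← abs_mul, abs_of_pos hL]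
          congr 1; ring
      _ ≤ L * |(a - y) - (b - y)| :=
          mul_le_mul_of_nonneg_left (abs_max_sub_max_le_abs _ _ _) hL.le
      _ = L * |a - b| := by congr 2; ring
  · intro x hx
    rw [hfy, add_sub_cancel_left]
    have hsub := h.sub x hx y hyI
    rcases le_or_gt x y with hxy | hxy
    · have hfx : f x = y + ε' := by
        simp only [hf, max_eq_right (sub_nonpos.2 hxy), mul_zero, sub_zero]
        exact max_eq_left (by linarith)
      rw [hfx]
      have := mul_le_mul_of_nonneg_right (h.mono hx.1 hxy hyI.2) (by linarith : 0 ≤ ε')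
      nlinarith
    · have hgx := hg.trans (h.mono hy hxy.le hx.2)
      rcases max_cases (y + ε' - L * max (x - y) 0) 0 with ⟨hm, -⟩ | ⟨hm, -⟩
      rotate_left
      · have : f x = 0 := hm
        rw [this]
        nlinarith [mul_nonneg hgx hy, mul_nonneg hg (by linarith : 0 ≤ ε')]
      · have : f x = y + ε' - L * (x - y) := by
          rw [← max_eq_left (sub_pos.2 hxy).le]; exact hm
        rw [this]
        have := hcon x hxy hx.2
        linarith

/-- If the better report `x` lies beyond `z`, the subgradient at `z` is already large. -/
lemma le_of_better_beyond (h : IsRobustScore G g ε L) {ε' w x z : ℝ}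
    (hw : 0 ≤ w) (hwz : w ≤ z) (hzx : z ≤ x) (hx : x ≤ 1)
    (hb : G w + g w * ε' < G x + g x * (ε' - (L + 1) * (x - w))) :
    g w * ε' + g x * (L * (x - w) - ε' + (z - w)) < (z - w) * g z := by
  have a := h.sub x ⟨by linarith, hx⟩ z ⟨by linarith, by linarith⟩
  have b := h.sub z ⟨by linarith, by linarith⟩ w ⟨hw, by linarith⟩
  linarith

lemma mul_le_of_better (h : IsRobustScore G g ε L) {ε' w x : ℝ}
    (hw : 0 ≤ w) (hwx : w ≤ x) (hx : x ≤ 1)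
    (hb : G w + g w * ε' < G x + g x * (ε' - (L + 1) * (x - w))) :
    g w * ε' < g x * (ε' - L * (x - w)) := by
  have a := h.sub x ⟨by linarith, hx⟩ w ⟨by linarith, by linarith⟩
  linarith

lemma growth_of_lt (h : IsRobustScore G g ε L) (hL : 0 < L) (hε : 0 < ε) {ε' y z : ℝ}
    (hε' : ε < ε') (hy : 0 ≤ y) (hyz : y ≤ z) (hz : z + L * ε' / (L + 1) ≤ 1)
    (hg : 0 ≤ g y) :
    min (Real.exp (L * (z - y - ε' / (L + 1)) / ε')) (1 + L) * g y ≤ g z := by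
  have hε'0 : 0 < ε' := hε.trans hε'
  have hL1 : 0 < L + 1 := by linarith
  have hsplit : ε' / (L + 1) + L * ε' / (L + 1) = ε' := by field_simp; ring
  have hpos : 0 < L * ε' / (L + 1) := by positivity
  have hz1 : z ≤ 1 := by linarith
  set A : Set ℝ := {w | w ∈ Icc y z ∧ g y * Real.exp (L * (w - y) / ε') ≤ g w}
  have hyA : y ∈ A := ⟨⟨le_rfl, hyz⟩, by simp⟩
  have hbdd : BddAbove A := ⟨z, fun w hw => hw.1.2⟩
  obtain ⟨w, hw⟩ : ∃ w, w = sSup A := ⟨_, rfl⟩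
  have hyw : y ≤ w := hw ▸ le_csSup hbdd hyA
  have hwz : w ≤ z := hw ▸ csSup_le ⟨y, hyA⟩ fun v hv => hv.1.2
  have hgw : g y * Real.exp (L * (w - y) / ε') ≤ g w := by
    have hcl : IsClosed {v : ℝ | g y * Real.exp (L * (v - y) / ε') ≤ g w} :=
      isClosed_le (by fun_prop) continuous_const
    have hsub : A ⊆ {v : ℝ | g y * Real.exp (L * (v - y) / ε') ≤ g w} := fun v hv =>
      hv.2.trans (h.mono (hy.trans hv.1.1) (hw ▸ le_csSup hbdd hv) (by linarith))
    have hmem := closure_minimal hsub hcl (csSup_mem_closure ⟨y, hyA⟩ hbdd)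
    rw [← hw] at hmem
    exact hmem
  have hgyw : g y ≤ g w := h.mono hy hyw (by linarith)
  rcases le_or_gt (z - w) (ε' / (L + 1)) with hclose | hfar
  · calc _ ≤ Real.exp (L * (z - y - ε' / (L + 1)) / ε') * g y :=
          mul_le_mul_of_nonneg_right (min_le_left _ _) hg
      _ ≤ Real.exp (L * (w - y) / ε') * g y := by
          gcongr ?_ * _
          refine Real.exp_le_exp.2 (div_le_div_of_nonneg_right ?_ hε'0.le)
          exact mul_le_mul_of_nonneg_left (by linarith) hL.le
      _ ≤ g w := by rwa [mul_comm]
      _ ≤ g z := h.mono (by linarith) hwz hz1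
  · obtain ⟨x, hwx, hx1, hb⟩ := h.exists_better hL hε hε' (hy.trans hyw) (by linarith)
      (hg.trans hgyw)
    have hgx : 0 ≤ g x := hg.trans (h.mono hy (by linarith) hx1)
    rcases le_or_gt x z with hxz | hzx
    · exfalso
      have h1 := h.mul_le_of_better (hy.trans hyw) hwx.le hx1 hb
      have h2 : g w ≤ g x * Real.exp (-(L * (x - w) / ε')) := by
        have h3 : g w ≤ g x * (1 - L * (x - w) / ε') := by
          refine le_of_mul_le_mul_right (h1.le.trans_eq ?_) hε'0
          field_simp
        refine h3.trans (mul_le_mul_of_nonneg_left ?_ hgx)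
        have := Real.add_one_le_exp (-(L * (x - w) / ε'))
        linarith
      have hxA : x ∈ A := by
        refine ⟨⟨by linarith, hxz⟩, ?_⟩
        have : Real.exp (L * (x - y) / ε')
            = Real.exp (L * (w - y) / ε') * Real.exp (L * (x - w) / ε') := by
          rw [← Real.exp_add]
          congr 1
          ring
        rw [this, ← mul_assoc]
        calc _ ≤ g w * Real.exp (L * (x - w) / ε') := by gcongr
          _ ≤ g x * Real.exp (-(L * (x - w) / ε')) * Real.exp (L * (x - w) / ε') := by gcongr
          _ = g x := by rw [mul_assoc, ← Real.exp_add]; simp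
      linarith [le_csSup hbdd hxA]
    · have h1 := h.le_of_better_beyond (hy.trans hyw) hwz hzx.le hx1 hb
      have hgz : 0 ≤ g z := hg.trans (h.mono hy hyz hz1)
      have hk : ε' < (z - w) * (L + 1) := (div_lt_iff₀ hL1).1 hfar
      have h2 : g z * (L * (z - w) - ε' + (z - w)) ≤ g x * (L * (x - w) - ε' + (z - w)) :=
        mul_le_mul (h.mono (by linarith) hzx.le hx1) (by nlinarith) (by linarith) hgx
      have h3 : g w * ε' ≤ g z * (ε' - L * (z - w)) := by linarith
      have h4 : g z * ((ε' - L * (z - w)) * (L + 1)) ≤ g z * ε' :=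
        mul_le_mul_of_nonneg_left (by nlinarith) hgz
      have h5 : (1 + L) * g w ≤ g z := by
        refine le_of_mul_le_mul_right ?_ hε'0
        nlinarith
      calc _ ≤ (1 + L) * g y := mul_le_mul_of_nonneg_right (min_le_right _ _) hg
        _ ≤ (1 + L) * g w := by gcongr
        _ ≤ g z := h5

/-- Nonnegative subgradients grow at least exponentially, up to an offset of `ε / (L + 1)`. -/
lemma growth (h : IsRobustScore G g ε L) (hL : 0 < L) (hε : 0 < ε) {y z : ℝ}
    (hy : 0 ≤ y) (hyz : y ≤ z) (hz : z + L * ε / (L + 1) < 1) (hg : 0 ≤ g y) :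
    min (Real.exp (L * (z - y - ε / (L + 1)) / ε)) (1 + L) * g y ≤ g z := by
  have hcont : ContinuousAt
      (fun e : ℝ => min (Real.exp (L * (z - y - e / (L + 1)) / e)) (1 + L) * g y) ε := by
    have : ContinuousAt (fun e : ℝ => L * (z - y - e / (L + 1)) / e) ε :=
      ContinuousAt.div (by fun_prop) continuousAt_id hε.ne'
    exact ((Real.continuous_exp.continuousAt.comp this).min continuousAt_const).mul_const _
  have hlt : ∀ᶠ e in nhds ε, z + L * e / (L + 1) < 1 :=
    (by fun_prop : ContinuousAt (fun e : ℝ => z + L * e / (L + 1)) ε).eventually_lt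
      continuousAt_const hz
  refine le_of_tendsto (hcont.tendsto.mono_left nhdsWithin_le_nhds : Filter.Tendsto _
    (nhdsWithin ε (Ioi ε)) _) ?_
  filter_upwards [nhdsWithin_le_nhds hlt, self_mem_nhdsWithin] with e he hεe
  exact h.growth_of_lt hL hε hεe hy hyz he.le hg

lemma strict_growth (h : IsRobustScore G g ε L) (hL : 0 < L) (hε : 0 < ε) {y z : ℝ}
    (hy : 0 ≤ y) (hyz : y + ε / (L + 1) < z) (hz : z + L * ε / (L + 1) < 1) (hg : 0 ≤ g y) :
    g y < g z := by
  have hL1 : 0 < L + 1 := by linarith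
  have hδ : 0 < ε / (L + 1) := by positivity
  rcases hg.eq_or_lt with h0 | hpos
  · obtain ⟨e, ⟨he, hze⟩, hεe⟩ : ∃ e, (y + e / (L + 1) < z ∧ z + L * e / (L + 1) < 1) ∧ ε < e := by
      have a : ∀ᶠ e in nhds ε, y + e / (L + 1) < z :=
        (by fun_prop : ContinuousAt (fun e : ℝ => y + e / (L + 1)) ε).eventually_lt
          continuousAt_const hyz
      have b : ∀ᶠ e in nhds ε, z + L * e / (L + 1) < 1 :=
        (by fun_prop : ContinuousAt (fun e : ℝ => z + L * e / (L + 1)) ε).eventually_lt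
          continuousAt_const hz
      have c : ∀ᶠ e in nhdsWithin ε (Ioi ε), y + e / (L + 1) < z ∧ z + L * e / (L + 1) < 1 :=
        nhdsWithin_le_nhds (a.and b)
      exact (c.and self_mem_nhdsWithin).exists
    have hsplit : e / (L + 1) + L * e / (L + 1) = e := by field_simp; ring
    have he0 : 0 < e := hε.trans hεe
    have : 0 < L * e / (L + 1) := by positivity
    obtain ⟨x, hyx, hx1, hb⟩ := h.exists_better hL hε hεe hy (by linarith) hg
    have h1 := h.mul_le_of_better hy hyx.le hx1 hb
    have hgx0 : 0 ≤ g x := hg.trans (h.mono hy hyx.le hx1)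
    have hgx : 0 < g x := by
      refine hgx0.lt_of_ne fun h' => ?_
      rw [← h', ← h0] at h1
      linarith
    rw [← h0]
    rcases le_or_gt x z with hxz | hzx
    · exact hgx.trans_le (h.mono (by linarith) hxz (by linarith))
    · have h2 := h.le_of_better_beyond hy (by linarith) hzx.le hx1 hb
      have hk : e < (z - y) * (L + 1) := (div_lt_iff₀ hL1).1 (by linarith)
      have h3 : 0 < L * (x - y) - e + (z - y) := by nlinarith
      rw [← h0] at h2
      have h4 : 0 < (z - y) * g z := by
        have := mul_pos hgx h3
        linarith
      exact pos_of_mul_pos_right h4 (by linarith)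
  · refine lt_of_lt_of_le ?_ (h.growth hL hε hy (by linarith) hz hg)
    refine lt_mul_of_one_lt_left hpos (lt_min (Real.one_lt_exp_iff.2 ?_) (by linarith))
    exact div_pos (mul_pos hL (by linarith)) hε

lemma growth_two (h : IsRobustScore G g ε L) (hL : 0 < L) (hε : 0 < ε) {y z : ℝ}
    (hy : 0 ≤ y) (hyz : z = y + 2 * (ε / (L + 1))) (hz : z + L * ε / (L + 1) < 1)
    (hg : 0 ≤ g y) : (2 * L + 1) * g y ≤ (L + 1) * g z := by
  have hL1 : 0 < L + 1 := by linarith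
  have hδ : 0 < ε / (L + 1) := by positivity
  have hexp : L * (z - y - ε / (L + 1)) / ε = L / (L + 1) := by
    rw [hyz]; field_simp; ring
  have hgr := h.growth hL hε hy (by linarith) hz hg
  rw [hexp] at hgr
  have hle : (2 * L + 1) / (L + 1) ≤ min (Real.exp (L / (L + 1))) (1 + L) := by
    refine le_min ?_ ?_
    · have := Real.add_one_le_exp (L / (L + 1))
      refine le_trans (le_of_eq ?_) this
      field_simp; ring
    · rw [div_le_iff₀ hL1]; nlinarith
  have := (mul_le_mul_of_nonneg_right hle hg).trans hgr
  rwa [div_mul_eq_mul_div, div_le_iff₀ hL1, mul_comm (g z)] at this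

lemma growth_four (h : IsRobustScore G g ε L) (hL : 0 < L) (hε : 0 < ε) {y z : ℝ}
    (hy : 0 ≤ y) (hyz : y + 4 * (ε / (L + 1)) ≤ z) (hz : z + L * ε / (L + 1) < 1)
    (hg : 0 ≤ g y) :
    3 * (L + 1) / (L + 3) * g y ≤ g z ∧
      3 * (L + 1) / (L + 3) * ((2 * L + 1) * g y) ≤ (L + 3) * g z := by
  have hL1 : 0 < L + 1 := by linarith
  have hL3 : 0 < L + 3 := by linarith
  have hδ : 0 < ε / (L + 1) := by positivity
  have hexp : 3 * (L / (L + 1)) ≤ L * (z - y - ε / (L + 1)) / ε := by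
    rw [le_div_iff₀ hε]
    have : L * (3 * (ε / (L + 1))) ≤ L * (z - y - ε / (L + 1)) :=
      mul_le_mul_of_nonneg_left (by linarith) hL.le
    calc _ = L * (3 * (ε / (L + 1))) := by ring
      _ ≤ _ := this
  have hgr := h.growth hL hε hy (by linarith) hz hg
  have hquad := Real.quadratic_le_exp_of_nonneg (x := 3 * (L / (L + 1))) (by positivity)
  have hquad' : (17 * L ^ 2 / 2 + 5 * L + 1) / (L + 1) ^ 2 ≤
      Real.exp (L * (z - y - ε / (L + 1)) / ε) := by
    refine le_trans (le_of_eq ?_) (hquad.trans (Real.exp_le_exp.2 hexp))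
    field_simp; ring
  have hle : 3 * (L + 1) / (L + 3) ≤ min (Real.exp (L * (z - y - ε / (L + 1)) / ε)) (1 + L) := by
    refine le_min (le_trans ?_ hquad') ?_
    · rw [div_le_div_iff₀ hL3 (by positivity), ← sub_nonneg]
      ring_nf
      positivity
    · rw [div_le_iff₀ hL3]; nlinarith
  have hle' : 3 * (L + 1) * (2 * L + 1) / (L + 3) ^ 2 ≤
      min (Real.exp (L * (z - y - ε / (L + 1)) / ε)) (1 + L) := by
    refine le_min (le_trans ?_ hquad') ?_
    · rw [div_le_div_iff₀ (by positivity) (by positivity), ← sub_nonneg]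
      ring_nf
      positivity
    · rw [div_le_iff₀ (by positivity), ← sub_nonneg]
      ring_nf
      positivity
  refine ⟨(mul_le_mul_of_nonneg_right hle hg).trans hgr, ?_⟩
  have := mul_le_mul_of_nonneg_left ((mul_le_mul_of_nonneg_right hle' hg).trans hgr) hL3.le
  refine le_trans (le_of_eq ?_) this
  field_simp

lemma growth_pow (h : IsRobustScore G g ε L) (hL : 0 < L) (hε : 0 < ε) (n : ℕ) :
    ∀ {y z : ℝ}, 0 ≤ y → y + 4 * (ε / (L + 1)) * (n + 1) ≤ z → z + L * ε / (L + 1) < 1 →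
      0 ≤ g y → (3 * (L + 1) / (L + 3)) ^ (n + 1) * ((2 * L + 1) * g y) ≤ (L + 3) * g z := by
  have hδ : 0 < ε / (L + 1) := by positivity
  have hLε : 0 < L * ε / (L + 1) := by positivity
  induction n with
  | zero =>
    intro y z hy hyz hz hg
    rw [zero_add, pow_one]
    exact (h.growth_four hL hε hy (by simpa using hyz) hz hg).2
  | succ n ih =>
    intro y z hy hyz hz hg
    push_cast at hyz
    have hn : 0 ≤ ε / (L + 1) * n := by positivity
    have hstep := (h.growth_four hL hε hy le_rfl (by linarith) hg).1
    have hg' : 0 ≤ g (y + 4 * (ε / (L + 1))) :=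
      hg.trans (h.mono hy (by linarith) (by linarith))
    refine le_trans ?_ (ih (y := y + 4 * (ε / (L + 1))) (by linarith) (by linarith) hz hg')
    calc _ = (3 * (L + 1) / (L + 3)) ^ (n + 1) * ((2 * L + 1) * (3 * (L + 1) / (L + 3) * g y)) := by
          ring
      _ ≤ _ := by gcongr

lemma growth_rpow (h : IsRobustScore G g ε L) (hL : 0 < L) (hε : 0 < ε) {y z r : ℝ}
    (hr : 0 ≤ r) (hy : 0 ≤ y) (hyz : y + 4 * (ε / (L + 1)) * (r + 1) ≤ z)
    (hz : z + L * ε / (L + 1) < 1) (hg : 0 ≤ g y) :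
    (3 * (L + 1) / (L + 3)) ^ r * ((2 * L + 1) * g y) ≤ (L + 3) * g z := by
  have hfloor := Nat.floor_le hr
  have hlt := Nat.lt_floor_add_one r
  refine le_trans ?_ (h.growth_pow hL hε ⌊r⌋₊ hy (le_trans ?_ hyz) hz hg)
  · rw [← Real.rpow_natCast]
    have hbase : 1 ≤ 3 * (L + 1) / (L + 3) := by
      rw [le_div_iff₀ (by linarith)]; linarith
    have hle : r ≤ ((⌊r⌋₊ + 1 : ℕ) : ℝ) := by push_cast; exact hlt.le
    exact mul_le_mul_of_nonneg_right (Real.rpow_le_rpow_of_exponent_le hbase hle)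
      (mul_nonneg (by linarith) hg)
  · gcongr

/-- On the working range the subgradient increases strictly over any distance above `ε / (L + 1)`. -/
lemma lt_of_window (h : IsRobustScore G g ε L) (hL : 0 < L) (hε : 0 < ε) {y z : ℝ}
    (hy : ε < y) (hyz : y + ε / (L + 1) < z) (hz : z + L * ε / (L + 1) < 1) : g y < g z := by
  have hδ : 0 < ε / (L + 1) := by positivity
  have hκ : 0 < L * ε / (L + 1) := by positivity
  have hsum : ε / (L + 1) + L * ε / (L + 1) = ε := by field_simp; ring
  rcases le_or_gt 0 (g y) with hgy | hgy
  · exact h.strict_growth hL hε (by linarith) hyz hz hgy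
  rcases le_or_gt (g z) 0 with hgz | hgz
  · have := h.reflect.strict_growth hL hε (y := 1 - z) (z := 1 - y) (by linarith) (by linarith)
      (by linarith) (by simpa using hgz)
    simpa using this
  · exact hgy.trans hgz

lemma second_difference_pos (h : IsRobustScore G g ε L) (hG : ConvexOn ℝ (Icc (0:ℝ) 1) G)
    (hL : 0 < L) (hε : 0 < ε) {p : ℝ} (hp : ε ≤ p) (hp1 : p ≤ 1 - 4 * ε) :
    0 < G p + G (p + 4 * (ε / (L + 1))) - 2 * G (p + 2 * (ε / (L + 1))) := by
  have hδ : 0 < ε / (L + 1) := by positivity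
  have hκ : 0 < L * ε / (L + 1) := by positivity
  have hsum : ε / (L + 1) + L * ε / (L + 1) = ε := by field_simp; ring
  set δ := ε / (L + 1)
  have hu : p + δ / 2 ∈ Icc (0:ℝ) 1 := ⟨by linarith, by linarith⟩
  have hv : p + 7 * δ / 2 ∈ Icc (0:ℝ) 1 := ⟨by linarith, by linarith⟩
  have hlt : g (p + δ / 2) < g (p + 7 * δ / 2) :=
    h.lt_of_window hL hε (by linarith) (by linarith) (by linarith)
  have hmid := hG.2 hu hv (by norm_num : (0:ℝ) ≤ 1 / 2) (by norm_num : (0:ℝ) ≤ 1 / 2) (by norm_num)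
  have hmid_eq : (1 / 2 : ℝ) • (p + δ / 2) + (1 / 2 : ℝ) • (p + 7 * δ / 2) = p + 2 * δ := by
    simp only [smul_eq_mul]; ring
  rw [hmid_eq] at hmid
  simp only [smul_eq_mul] at hmid
  have a := h.sub _ hu p ⟨by linarith, by linarith⟩
  have b := h.sub _ hv (p + 4 * δ) ⟨by linarith, by linarith⟩
  have c : 0 < (g (p + 7 * δ / 2) - g (p + δ / 2)) * (δ / 2) :=
    mul_pos (by linarith) (by linarith)
  linarith

/-- If the misreporting cost is at most `4δ·g y` at one place and at least
`2δ·(g z - g (z - 2δ))` at another, the growth of `g` from `y` to `z` bounds their ratio. -/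
lemma cost_ratio (h : IsRobustScore G g ε L) (hL : 0 < L) (hε : 0 < ε) {y z r a b : ℝ}
    (hr : 0 ≤ r) (hy : 0 ≤ y) (hyz : y + 4 * (ε / (L + 1)) * (r + 1) ≤ z)
    (hz : z + L * ε / (L + 1) < 1) (hg : 0 ≤ g y)
    (ha : a ≤ 4 * (ε / (L + 1)) * g y)
    (hb : 2 * (ε / (L + 1)) * (g z - g (z - 2 * (ε / (L + 1)))) ≤ b) :
    L / (2 * L + 6) * (3 * (L + 1) / (L + 3)) ^ r * a ≤ b := by
  have hδ : 0 < ε / (L + 1) := by positivity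
  have hκ : 0 < L * ε / (L + 1) := by positivity
  have hrow := h.growth_rpow hL hε hr hy hyz hz hg
  set δ := ε / (L + 1) with hδ_def
  have hδr : 0 ≤ δ * r := by positivity
  have hgz : 0 ≤ g (z - 2 * δ) := hg.trans (h.mono hy (by linarith) (by linarith))
  have htwo := h.growth_two hL hε (y := z - 2 * δ) (z := z) (by linarith) (by linarith) hz hgz
  have hstep : L * g z ≤ (2 * L + 1) * (g z - g (z - 2 * δ)) := by linarith
  have hρ : 0 ≤ (3 * (L + 1) / (L + 3)) ^ r := by positivity
  set ρ := (3 * (L + 1) / (L + 3)) ^ r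
  have hL2 : 0 < 2 * L + 1 := by linarith
  have hL3 : 0 < L + 3 := by linarith
  calc _ ≤ L / (2 * L + 6) * ρ * (4 * δ * g y) := by gcongr
    _ = 2 * δ * (L / ((L + 3) * (2 * L + 1))) * (ρ * ((2 * L + 1) * g y)) := by
        rw [show 2 * L + 6 = 2 * (L + 3) by ring]; field_simp; ring
    _ ≤ 2 * δ * (L / ((L + 3) * (2 * L + 1))) * ((L + 3) * g z) := by gcongr
    _ = 2 * δ / (2 * L + 1) * (L * g z) := by field_simp
    _ ≤ 2 * δ / (2 * L + 1) * ((2 * L + 1) * (g z - g (z - 2 * δ))) := by gcongr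
    _ = 2 * δ * (g z - g (z - 2 * δ)) := by field_simp
    _ ≤ b := hb

end IsRobustScore

/-- (Binary case.) Suppose `S(p,q) = g p * (q - p) + G p` is a proper
scoring rule such that for some `ε, L_f > 0`, whenever `f : [0,1] → [0,1]` is
`L_f`-Lipschitz, every performatively optimal report `p` satisfies `|f p − p| ≤ ε`.
Let `3ε ≤ p_l ≤ p_h ≤ 1 − 4ε` and `δ := ε/(L_f + 1)`. Then the ratio of the supremum
and the infimum over `p ∈ [p_l, p_h]` of `|S(p + 4δ, p) − S(p, p)|` is at least
`(L_f/(2L_f + 6)) · (3(L_f+1)/(L_f+3))^((L_f+1)(p_h−p_l)/(8ε) − 5/2)`. -/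
theorem stmt13 (G g : ℝ → ℝ) (S : ℝ → ℝ → ℝ)
    (hconv : ConvexOn ℝ (Icc (0:ℝ) 1) G)
    (hsub : ∀ p ∈ Icc (0:ℝ) 1, ∀ q ∈ Icc (0:ℝ) 1, G p + g p * (q - p) ≤ G q)
    (hS : ∀ p q : ℝ, S p q = g p * (q - p) + G p)
    (ε Lf : ℝ) (hε : 0 < ε) (hLf : 0 < Lf)
    (hprop : ∀ f : ℝ → ℝ, (∀ x ∈ Icc (0:ℝ) 1, f x ∈ Icc (0:ℝ) 1) →
      (∀ x ∈ Icc (0:ℝ) 1, ∀ y ∈ Icc (0:ℝ) 1, |f x - f y| ≤ Lf * |x - y|) →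
      ∀ p ∈ Icc (0:ℝ) 1,
        (∀ x ∈ Icc (0:ℝ) 1, S x (f x) ≤ S p (f p)) →
        |f p - p| ≤ ε)
    (δ : ℝ) (hδ : δ = ε / (Lf + 1))
    (pl ph : ℝ) (h1 : 3 * ε ≤ pl) (h2 : pl ≤ ph) (h3 : ph ≤ 1 - 4 * ε) :
    Lf / (2 * Lf + 6) *
        (3 * (Lf + 1) / (Lf + 3)) ^ ((Lf + 1) * (ph - pl) / (8 * ε) - 5 / 2) ≤
      sSup ((fun p => |S (p + 4 * δ) p - S p p|) '' Icc pl ph) /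
        sInf ((fun p => |S (p + 4 * δ) p - S p p|) '' Icc pl ph) := by
  subst hδ
  have h : IsRobustScore G g ε Lf := ⟨hsub, by simpa only [hS] using hprop⟩
  have hδ : 0 < ε / (Lf + 1) := by positivity
  have hκ : 0 < Lf * ε / (Lf + 1) := by positivity
  have hsum : ε / (Lf + 1) + Lf * ε / (Lf + 1) = ε := by field_simp; ring
  have hexp : (Lf + 1) * (ph - pl) / (8 * ε) = (ph - pl) / (8 * (ε / (Lf + 1))) := by
    field_simp
  rw [hexp]
  set δ := ε / (Lf + 1) with hδ_def
  set D : ℝ → ℝ := fun p => |S (p + 4 * δ) p - S p p| with hD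
  have hmem : ∀ p ∈ Icc pl ph, p ∈ Icc (0:ℝ) 1 ∧ p + 2 * δ ∈ Icc (0:ℝ) 1 ∧
      p + 4 * δ ∈ Icc (0:ℝ) 1 := fun p hp => by
    obtain ⟨ha, hb⟩ := hp
    refine ⟨⟨?_, ?_⟩, ⟨?_, ?_⟩, ⟨?_, ?_⟩⟩ <;> linarith
  have hD_eq : ∀ p ∈ Icc pl ph, D p = G p - G (p + 4 * δ) + 4 * δ * g (p + 4 * δ) := by
    intro p hp
    obtain ⟨m0, -, m4⟩ := hmem p hp
    have := hsub _ m4 p m0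
    simp only [hD, hS]
    rw [abs_of_nonpos (by linarith)]
    ring
  have hD_le : ∀ p ∈ Icc pl ph, D p ≤ 4 * δ * (g (p + 4 * δ) - g p) := by
    intro p hp
    obtain ⟨m0, -, m4⟩ := hmem p hp
    have := hsub p m0 _ m4
    rw [hD_eq p hp]
    linarith
  have hD_ge : ∀ p ∈ Icc pl ph, 2 * δ * (g (p + 4 * δ) - g (p + 2 * δ)) ≤ D p := by
    intro p hp
    obtain ⟨m0, m2, m4⟩ := hmem p hp
    have a := hsub _ m2 p m0
    have b := hsub _ m4 _ m2
    rw [hD_eq p hp]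
    linarith
  have hne : (D '' Icc pl ph).Nonempty := (nonempty_Icc.2 h2).image _
  have hbdd : BddAbove (D '' Icc pl ph) := by
    refine ⟨4 * δ * (g (ph + 4 * δ) - g pl), ?_⟩
    rintro _ ⟨p, hp, rfl⟩
    refine (hD_le p hp).trans (mul_le_mul_of_nonneg_left ?_ (by linarith))
    have a := h.mono (x := p + 4 * δ) (y := ph + 4 * δ) (by linarith [hp.1]) (by linarith [hp.2])
      (by linarith)
    have b := h.mono (x := pl) (y := p) (by linarith) hp.1 (by linarith [hp.2])
    linarith
  have hinf : 0 < sInf (D '' Icc pl ph) := by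
    have hcont := hconv.continuousOn_interior
    rw [interior_Icc] at hcont
    have hE : ContinuousOn (fun p => G p + G (p + 4 * δ) - 2 * G (p + 2 * δ)) (Icc pl ph) := by
      refine ((hcont.mono ?_).add (hcont.comp (by fun_prop) ?_)).sub
        (continuousOn_const.mul (hcont.comp (by fun_prop) ?_))
      all_goals
        rintro p ⟨ha, hb⟩
        constructor <;> linarith
    obtain ⟨p₀, hp₀, hmin⟩ := isCompact_Icc.exists_isMinOn (nonempty_Icc.2 h2) hE
    refine (h.second_difference_pos hconv hLf hε (p := p₀) (by linarith [hp₀.1])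
      (by linarith [hp₀.2])).trans_le (le_csInf hne ?_)
    rintro _ ⟨p, hp, rfl⟩
    refine (isMinOn_iff.1 hmin p hp).trans ?_
    obtain ⟨-, m2, m4⟩ := hmem p hp
    have b := hsub _ m4 _ m2
    rw [hD_eq p hp]
    linarith
  have hfinish : ∀ C, 0 ≤ C → (∃ a ∈ Icc pl ph, ∃ b ∈ Icc pl ph, C * D a ≤ D b) →
      C ≤ sSup (D '' Icc pl ph) / sInf (D '' Icc pl ph) := by
    rintro C hC ⟨a, ha, b, hb, hab⟩
    rw [le_div_iff₀ hinf]
    have hbelow : BddBelow (D '' Icc pl ph) := ⟨0, by rintro _ ⟨p, -, rfl⟩; exact abs_nonneg _⟩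
    calc _ ≤ C * D a := mul_le_mul_of_nonneg_left (csInf_le hbelow ⟨a, ha, rfl⟩) hC
      _ ≤ D b := hab
      _ ≤ _ := le_csSup hbdd ⟨b, hb, rfl⟩
  apply hfinish _ (by positivity)
  set r := (ph - pl) / (8 * δ) - 5 / 2 with hr_def
  have hr_mul : 8 * δ * (r + 5 / 2) = ph - pl := by
    rw [hr_def]; field_simp; ring
  rcases le_or_gt r 0 with hr | hr
  · refine ⟨pl, ⟨le_rfl, h2⟩, pl, ⟨le_rfl, h2⟩, mul_le_of_le_one_left (abs_nonneg _) ?_⟩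
    refine mul_le_one₀ ?_ (by positivity) (Real.rpow_le_one_of_one_le_of_nonpos ?_ hr)
    · rw [div_le_one (by positivity)]; linarith
    · rw [le_div_iff₀ (by linarith)]; linarith
  have hδr : 0 < δ * r := mul_pos hδ hr
  rcases le_or_gt 0 (g ((pl + ph) / 2)) with hM | hM
  · refine ⟨(pl + ph) / 2, ⟨by linarith, by linarith⟩, ph, ⟨h2, le_rfl⟩, ?_⟩
    refine h.cost_ratio hLf hε (y := (pl + ph) / 2 + 4 * δ) (z := ph + 4 * δ) hr.le (by linarith)
      (by linarith) (by linarith)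
      (hM.trans (h.mono (by linarith) (by linarith) (by linarith))) ?_ ?_
    · refine (hD_le _ ⟨by linarith, by linarith⟩).trans
        (mul_le_mul_of_nonneg_left (by linarith) (by linarith))
    · have := hD_ge ph ⟨h2, le_rfl⟩
      rwa [show ph + 4 * δ - 2 * δ = ph + 2 * δ by ring]
  · refine ⟨(pl + ph) / 2 - 4 * δ, ⟨by linarith, by linarith⟩, pl, ⟨le_rfl, h2⟩, ?_⟩
    have hle := h.mono (x := (pl + ph) / 2 - 4 * δ) (y := (pl + ph) / 2) (by linarith)
      (by linarith) (by linarith)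
    refine h.reflect.cost_ratio hLf hε (y := 1 - ((pl + ph) / 2 - 4 * δ))
      (z := 1 - (pl + 2 * δ)) hr.le (by linarith) (by linarith) (by linarith) ?_ ?_ ?_
    · simp only [sub_sub_cancel]; linarith
    · simp only [sub_sub_cancel]
      refine (hD_le _ ⟨by linarith, by linarith⟩).trans
        (mul_le_mul_of_nonneg_left ?_ (by linarith))
      rw [sub_add_cancel]
      linarith
    · have := hD_ge pl ⟨le_rfl, h2⟩
      rw [sub_sub_cancel, show 1 - (1 - (pl + 2 * δ) - 2 * δ) = pl + 4 * δ by ring]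
      linarith
end

section
/- Let S be a proper scoring rule with G and its subgradient g differentiable. Then for any p ∈ Δ, the gradient (in the tangent space T) of the map x ↦ S(x, q), evaluated at x = p with q := f(p) held fixed (the 'stop-gradient' objective), equals Dg(p)ᵀ(f(p) − p). In particular, if p is a fixed point of f then this gradient is 0; conversely, if Dg(p)|_T ≻ 0 (i.e. vᵀ Dg(p) v > 0 for all nonzero v ∈ T) and the gradient is 0, then p is a fixed point of f. -/
open Set
open scoped RealInnerProductSpace

noncomputable section

/-- Let `S(x,q) = G x + ⟪g x, q - x⟫` be a proper scoring rule with `G`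
and its subgradient `g` differentiable at `p ∈ Δ` (along the tangent space `T`, with
Jacobian `Dg` of `g`). Then the gradient in `T` of the stop-gradient objective
`x ↦ S(x, f p)` at `x = p` equals `Dg(p)ᵀ(f p − p)`: for every `v ∈ T`, the derivative of
`t ↦ S(p + t v, f p)` at `t = 0` is `⟪f p - p, Dg v⟫`. In particular, if `p` is a fixed
point of `f` then this gradient vanishes on `T`; conversely, if `Dg(p)|_T ≻ 0` and the
gradient vanishes on `T`, then `p` is a fixed point of `f`. -/
theorem stmt16 (n : ℕ)
    (G : EuclideanSpace ℝ (Fin n) → ℝ)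
    (g f : EuclideanSpace ℝ (Fin n) → EuclideanSpace ℝ (Fin n))
    (hconv : ConvexOn ℝ (probSimplex n) G)
    (hsub : ∀ q ∈ probSimplex n, ∀ r ∈ probSimplex n, G q + ⟪g q, r - q⟫ ≤ G r)
    (hgT : ∀ q ∈ probSimplex n, g q ∈ tangentSp n)
    (hf : ∀ q ∈ probSimplex n, f q ∈ probSimplex n)
    (p : EuclideanSpace ℝ (Fin n)) (hp : p ∈ probSimplex n)
    (Dg : EuclideanSpace ℝ (Fin n) →L[ℝ] EuclideanSpace ℝ (Fin n))
    (hG' : ∀ v ∈ tangentSp n, HasDerivAt (fun t : ℝ => G (p + t • v)) ⟪g p, v⟫ 0)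
    (hg' : ∀ v ∈ tangentSp n, HasDerivAt (fun t : ℝ => g (p + t • v)) (Dg v) 0) :
    (∀ v ∈ tangentSp n,
      HasDerivAt (fun t : ℝ => G (p + t • v) + ⟪g (p + t • v), f p - (p + t • v)⟫)
        ⟪f p - p, Dg v⟫ 0) ∧
    (f p = p → ∀ v ∈ tangentSp n, ⟪f p - p, Dg v⟫ = 0) ∧
    ((∀ v ∈ tangentSp n, v ≠ 0 → 0 < ⟪v, Dg v⟫) →
      (∀ v ∈ tangentSp n, ⟪f p - p, Dg v⟫ = 0) → f p = p) := by
  refine ⟨fun v hv => ?_, fun h v _ => by simp [h], fun hpos hzero => ?_⟩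
  · have hline : HasDerivAt (fun t : ℝ => f p - (p + t • v)) (-v) 0 := by
      simpa using (((hasDerivAt_id (0 : ℝ)).smul_const v).const_add p).const_sub (f p)
    refine ((hG' v hv).add ((hg' v hv).inner ℝ hline)).congr_deriv ?_
    simp [inner_neg_right, real_inner_comm]
  · have hmem : f p - p ∈ tangentSp n := by
      simp [tangentSp, Finset.sum_sub_distrib, (hf p hp).2, hp.2]
    by_contra hne
    exact (hpos _ hmem (sub_ne_zero.mpr hne)).ne' (hzero _ hmem)
end
end

section
/- Consider N players with weights w_1, …, w_N ∈ [0,1], Σ_n w_n = 1, where each player n submits a report p_n ∈ Δ and receives expected payoff S(p_n, f(Σ_m w_m p_m)). Let (p_n)_n be a pure-strategy Nash equilibrium (each p_n maximizes x ↦ S(x, f(w_n x + Σ_{m ≠ n} w_m p_m)) over x ∈ Δ) and let p̂ := Σ_n w_n p_n be the market prediction. Assume f is differentiable at p̂. Then for any player n at whose report G and g are differentiable and Dg(p_n)|_T ⪰ γ_{p_n} > 0, it holds that ‖f(p̂) − p_n‖ ≤ w_n · ‖Df(p̂)‖_op · ‖g(p_n)‖ / γ_{p_n}. -/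
open Set
open scoped RealInnerProductSpace

noncomputable section

/-- A function on `ℝ` that does not exceed its value at `0` on `(0, 1)` has nonpositive derivative
at `0`. -/
theorem HasDerivAt.nonpos_of_le_right {φ : ℝ → ℝ} {c : ℝ} (h : HasDerivAt φ c 0)
    (hle : ∀ t ∈ Ioo (0 : ℝ) 1, φ t ≤ φ 0) : c ≤ 0 := by
  refine le_of_tendsto h.tendsto_slope_zero_right ?_
  filter_upwards [Ioo_mem_nhdsGT (zero_lt_one' ℝ)] with t ht
  rw [zero_add, smul_eq_mul]
  exact mul_nonpos_of_nonneg_of_nonpos (inv_nonneg.2 ht.1.le) (sub_nonpos.2 (hle t ht))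

theorem smul_mem_tangentSp {n : ℕ} {v : EuclideanSpace ℝ (Fin n)} (c : ℝ)
    (hv : v ∈ tangentSp n) : c • v ∈ tangentSp n := by
  have hv' : ∑ i, v i = 0 := hv
  simp [tangentSp, ← Finset.mul_sum, hv']

/-- (Prediction market.) `N` players with weights `w_1,…,w_N ∈ [0,1]`
summing to 1 each submit a report `p_m ∈ Δ` and receive expected payoff
`S(p_m, f(∑_k w_k p_k))`, where `S(x,q) = G x + ⟪g x, q - x⟫` is a proper scoring rule.
Let `(p_m)_m` be a pure-strategy Nash equilibrium (each `p_m` maximizes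
`x ↦ S(x, f(w_m x + ∑_{k ≠ m} w_k p_k))` over `Δ`) and `p̂ := ∑_m w_m p_m`. If `f` is
differentiable at `p̂` (with Jacobian `Df` on `T`), and `G, g` are differentiable at `p_i`
with `Dg(p_i)|_T ⪰ γ > 0`, then `‖f(p̂) − p_i‖ ≤ w_i · ‖Df(p̂)‖_op · ‖g(p_i)‖ / γ`
(expressed via all upper bounds `M` of the operator norm of `Df(p̂)` on `T`). -/
theorem stmt18 (n N : ℕ)
    (G : EuclideanSpace ℝ (Fin n) → ℝ)
    (g f : EuclideanSpace ℝ (Fin n) → EuclideanSpace ℝ (Fin n))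
    (hconv : ConvexOn ℝ (probSimplex n) G)
    (hsub : ∀ q ∈ probSimplex n, ∀ r ∈ probSimplex n, G q + ⟪g q, r - q⟫ ≤ G r)
    (hgT : ∀ q ∈ probSimplex n, g q ∈ tangentSp n)
    (hf : ∀ q ∈ probSimplex n, f q ∈ probSimplex n)
    (w : Fin N → ℝ) (hw0 : ∀ m, 0 ≤ w m) (hw1 : ∀ m, w m ≤ 1) (hwsum : ∑ m, w m = 1)
    (p : Fin N → EuclideanSpace ℝ (Fin n)) (hpΔ : ∀ m, p m ∈ probSimplex n)
    (phat : EuclideanSpace ℝ (Fin n)) (hphat : phat = ∑ m, w m • p m)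
    (hNash : ∀ m : Fin N, ∀ x ∈ probSimplex n,
      G x + ⟪g x, f (w m • x + ∑ k ∈ Finset.univ.erase m, w k • p k) - x⟫ ≤
        G (p m) + ⟪g (p m), f phat - p m⟫)
    (Df : EuclideanSpace ℝ (Fin n) →L[ℝ] EuclideanSpace ℝ (Fin n))
    (hDf : ∀ v ∈ tangentSp n, HasDerivAt (fun t : ℝ => f (phat + t • v)) (Df v) 0)
    (i : Fin N)
    (Dg : EuclideanSpace ℝ (Fin n) →L[ℝ] EuclideanSpace ℝ (Fin n))
    (hG' : ∀ v ∈ tangentSp n, HasDerivAt (fun t : ℝ => G (p i + t • v)) ⟪g (p i), v⟫ 0)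
    (hg' : ∀ v ∈ tangentSp n, HasDerivAt (fun t : ℝ => g (p i + t • v)) (Dg v) 0)
    (γ : ℝ) (hγ : 0 < γ)
    (hpos : ∀ v ∈ tangentSp n, γ * ‖v‖ ^ 2 ≤ ⟪v, Dg v⟫) :
    ∀ M : ℝ, (∀ v ∈ tangentSp n, ‖Df v‖ ≤ M * ‖v‖) →
      ‖f phat - p i‖ ≤ w i * M * ‖g (p i)‖ / γ := by
  intro M hM
  have hphatΔ : phat ∈ probSimplex n :=
    hphat ▸ (convex_probSimplex n).sum_mem (fun m _ => hw0 m) hwsum fun m _ => hpΔ m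
  set d := f phat - p i with hd
  have hdT : d ∈ tangentSp n := sub_mem_tangentSp (hf _ hphatΔ) (hpΔ i)
  have hline : ∀ t ∈ Ioo (0 : ℝ) 1, p i + t • d ∈ probSimplex n := fun t ht =>
    (convex_probSimplex n).add_smul_sub_mem (hpΔ i) (hf _ hphatΔ) ⟨ht.1.le, ht.2.le⟩
  have hmarket : ∀ t : ℝ, w i • (p i + t • d) + ∑ k ∈ Finset.univ.erase i, w k • p k =
      phat + t • (w i • d) := by
    intro t
    rw [hphat, ← Finset.add_sum_erase _ _ (Finset.mem_univ i)]
    module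
  have hfirst : ⟪g (p i), d⟫ + (⟪g (p i), Df (w i • d) - d⟫ + ⟪Dg d, d⟫) ≤ 0 := by
    have hx : HasDerivAt (fun t : ℝ => p i + t • d) d 0 := by
      simpa using ((hasDerivAt_id (0 : ℝ)).smul_const d).const_add (p i)
    have hφ := (hG' d hdT).add
      ((hg' d hdT).inner ℝ ((hDf _ (smul_mem_tangentSp (w i) hdT)).sub hx))
    refine HasDerivAt.nonpos_of_le_right (by simpa [← hd] using hφ) fun t ht => ?_
    have h := hNash i _ (hline t ht)
    rw [hmarket] at h
    simpa using h
  have hkey : γ * ‖d‖ ^ 2 ≤ w i * (‖g (p i)‖ * (M * ‖d‖)) := by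
    have hcs : -⟪g (p i), Df d⟫ ≤ ‖g (p i)‖ * (M * ‖d‖) :=
      (neg_le_abs _).trans <| (abs_real_inner_le_norm _ _).trans <|
        mul_le_mul_of_nonneg_left (hM d hdT) (norm_nonneg _)
    have hcs' := mul_le_mul_of_nonneg_left hcs (hw0 i)
    have hcoer := hpos d hdT
    rw [inner_sub_right _ (Df _) d, map_smul, inner_smul_right, real_inner_comm d (Dg d)] at hfirst
    linarith
  rw [le_div_iff₀ hγ]
  rcases (norm_nonneg d).eq_or_lt with h0 | h0
  · rw [← h0, zero_mul]
    rcases (norm_nonneg (g (p i))).eq_or_lt with hg0 | hg0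
    · rw [← hg0, mul_zero]
    · have hM0 : 0 ≤ M :=
        nonneg_of_mul_nonneg_left ((norm_nonneg _).trans (hM _ (hgT _ (hpΔ i)))) hg0
      exact mul_nonneg (mul_nonneg (hw0 i) hM0) hg0.le
  · refine le_of_mul_le_mul_right ?_ h0
    linarith
end
end
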